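/- arXiv:1002.1472 — 3 statements merged into one kernel-verified Lean document; each statement's English description precedes it below -/
import Mathlib

section
/- Let α : ℝ³∖{0} → ℝ be C² and homogeneous of degree 0 (α(λx) = α(x) for all λ > 0), i.e. a C² function on the unit sphere S², and set σ_ij(x) = (α(x)/r)(x_i x_j/r² − δ_ij/2) with r = |x|. Then σ satisfies the linearized scalar constraint equation Σ_{i,j}(∂_i∂_j σ_ij − ∂_j∂_j σ_ii) = 0 at every point of ℝ³∖{0}. -/
noncomputable section

/-- Points of `ℝ³`. -/
abbrev E3 := EuclideanSpace ℝ (Fin 3)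

/-- Partial derivative of `f` in the `i`-th coordinate direction. -/
def pd (f : E3 → ℝ) (i : Fin 3) (x : E3) : ℝ :=
  fderiv ℝ f x (EuclideanSpace.single i 1)

/-- The tensor `σ_ij = (α/r)(x_i x_j/r² − δ_ij/2)`. -/
def sigmaT (α : E3 → ℝ) (i j : Fin 3) (x : E3) : ℝ :=
  (α x / ‖x‖) * (x i * x j / ‖x‖ ^ 2 - (if i = j then (1 : ℝ) else 0) / 2)

open Filter Topology

lemma pd_congr {f g : E3 → ℝ} {x : E3} (hx : x ≠ 0) (h : ∀ y, y ≠ 0 → f y = g y) (i : Fin 3) :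
    pd f i x = pd g i x := by
  have : f =ᶠ[𝓝 x] g := by
    filter_upwards [isOpen_ne.mem_nhds hx] with y hy using h y hy
  simp only [pd, this.fderiv_eq]

lemma pd_mul {f g : E3 → ℝ} {x : E3} (hf : DifferentiableAt ℝ f x)
    (hg : DifferentiableAt ℝ g x) (i : Fin 3) :
    pd (fun y => f y * g y) i x = f x * pd g i x + g x * pd f i x := by
  simp [pd, fderiv_fun_mul hf hg]

lemma pd_sub {f g : E3 → ℝ} {x : E3} (hf : DifferentiableAt ℝ f x)
    (hg : DifferentiableAt ℝ g x) (i : Fin 3) :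
    pd (fun y => f y - g y) i x = pd f i x - pd g i x := by
  simp [pd, fderiv_fun_sub hf hg]

lemma pd_const_mul {f : E3 → ℝ} {x : E3} (hf : DifferentiableAt ℝ f x) (c : ℝ) (i : Fin 3) :
    pd (fun y => c * f y) i x = c * pd f i x := by
  simp [pd, fderiv_const_mul hf]

lemma pd_sum {f : Fin 3 → E3 → ℝ} {x : E3} (hf : ∀ k, DifferentiableAt ℝ (f k) x) (i : Fin 3) :
    pd (fun y => ∑ k, f k y) i x = ∑ k, pd (f k) i x := by
  simp [pd, fderiv_fun_sum fun k _ => hf k]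

lemma differentiable_coord (j : Fin 3) : Differentiable ℝ fun y : E3 => y j := by
  fun_prop

lemma pd_coord (i j : Fin 3) (x : E3) : pd (fun y => y j) i x = if i = j then 1 else 0 := by
  have : HasFDerivAt (fun y : E3 => y j) (EuclideanSpace.proj j : E3 →L[ℝ] ℝ) x :=
    (EuclideanSpace.proj j : E3 →L[ℝ] ℝ).hasFDerivAt
  simp [pd, this.fderiv, eq_comm]

lemma differentiableAt_pd {f : E3 → ℝ} {x : E3} (hf : ContDiffAt ℝ 2 f x) (i : Fin 3) :
    DifferentiableAt ℝ (pd f i) x := by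
  have h : DifferentiableAt ℝ (fderiv ℝ f) x :=
    (hf.fderiv_right (m := 1) (by norm_num)).differentiableAt (by norm_num)
  exact h.clm_apply (differentiableAt_const _)

lemma fderiv_self_eq_sum_pd (f : E3 → ℝ) (x : E3) : fderiv ℝ f x x = ∑ i, x i * pd f i x := by
  have hx : x = ∑ i, x i • EuclideanSpace.single i (1 : ℝ) := by
    ext j
    simp [Pi.single_apply]
  conv_lhs => rw [hx]
  simp only [map_sum, map_smul, smul_eq_mul, pd]
  rw [← hx]

/-- Euler's identity for functions homogeneous of degree `-3`. -/
lemma euler_of_homogeneous_neg_three {f : E3 → ℝ} {x : E3} (hf : DifferentiableAt ℝ f x)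
    (hhom : ∀ c : ℝ, 0 < c → f (c • x) = f x / c ^ 3) :
    ∑ i, x i * pd f i x = -3 * f x := by
  rw [← fderiv_self_eq_sum_pd]
  have hline : HasDerivAt (fun c : ℝ => c • x) x 1 := by
    simpa using (hasDerivAt_id (1 : ℝ)).smul_const x
  have hleft : HasDerivAt (fun c : ℝ => f (c • x)) (fderiv ℝ f x x) 1 := by
    have hf' : HasFDerivAt f (fderiv ℝ f x) ((1 : ℝ) • x) := by simpa using hf.hasFDerivAt
    exact hf'.comp_hasDerivAt 1 hline
  have hright : HasDerivAt (fun c : ℝ => f x / c ^ 3) (-3 * f x) 1 := by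
    have := (hasDerivAt_const (1 : ℝ) (f x)).div (hasDerivAt_pow 3 (1 : ℝ)) (by norm_num)
    exact this.congr_deriv (by norm_num; ring)
  refine hleft.unique (hright.congr_of_eventuallyEq ?_)
  filter_upwards [lt_mem_nhds (zero_lt_one' ℝ)] with c hc using hhom c hc

/-- The divergence of `ψ x g`, for `ψ` of degree `-3`, is `ψ` times the radial derivative of `g`. -/
lemma sum_pd_mul_coord_mul {ψ g : E3 → ℝ} {x : E3} (hψ : DifferentiableAt ℝ ψ x)
    (hg : DifferentiableAt ℝ g x) (heuler : ∑ i, x i * pd ψ i x = -3 * ψ x) :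
    ∑ i, pd (fun y => ψ y * y i * g y) i x = ψ x * ∑ i, x i * pd g i x := by
  have hterm (i : Fin 3) : pd (fun y => ψ y * y i * g y) i x
      = ψ x * (x i * pd g i x) + g x * (x i * pd ψ i x) + g x * ψ x := by
    rw [pd_mul (hψ.fun_mul (differentiable_coord i x)) hg, pd_mul hψ (differentiable_coord i x),
      pd_coord]
    simp only [if_true]
    ring
  simp only [hterm, Finset.sum_add_distrib, ← Finset.mul_sum, heuler]
  simp

lemma sum_mul_pd_coord (j : Fin 3) (x : E3) : ∑ i, x i * pd (fun y => y j) i x = x j := by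
  simp [pd_coord]

lemma sigmaT_eq (α : E3 → ℝ) (i j : Fin 3) (x : E3) :
    sigmaT α i j x = α x / ‖x‖ ^ 3 * x i * x j
      - (if i = j then (1 : ℝ) else 0) / 2 * (α x / ‖x‖) := by
  unfold sigmaT
  rw [mul_sub]
  congr 1
  · rw [pow_succ ‖x‖ 2]
    simp only [div_eq_mul_inv, mul_inv]
    ring
  · ring

lemma sum_sigmaT_diag (α : E3 → ℝ) {x : E3} (hx : x ≠ 0) :
    ∑ i, sigmaT α i i x = (-1 / 2) * (α x / ‖x‖) := by
  have hr : ‖x‖ ≠ 0 := norm_ne_zero_iff.mpr hx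
  have hsq : ‖x‖ ^ 2 = x 0 * x 0 + x 1 * x 1 + x 2 * x 2 := by
    rw [EuclideanSpace.norm_sq_eq]
    simp [Fin.sum_univ_three, sq]
  have hsum : ∑ i, sigmaT α i i x
      = α x / ‖x‖ * ((x 0 * x 0 + x 1 * x 1 + x 2 * x 2) / ‖x‖ ^ 2 - 3 / 2) := by
    simp only [sigmaT, Fin.sum_univ_three, if_true]
    ring
  rw [hsum, ← hsq, div_self (pow_ne_zero 2 hr)]
  ring

/-- for `α` a C² function on the sphere (i.e. C² on `ℝ³∖{0}` and homogeneous of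
degree 0), the tensor `σ_ij = (α/r)(x_i x_j/r² − δ_ij/2)` satisfies the linearized scalar
constraint equation `Σ_{i,j} (∂_i∂_j σ_ij − ∂_j∂_j σ_ii) = 0` on `ℝ³∖{0}`. -/
theorem sigma_satisfies_linearized_scalar_constraint
    (α : E3 → ℝ)
    (hα : ContDiffOn ℝ 2 α {x : E3 | x ≠ 0})
    (hhom : ∀ c : ℝ, 0 < c → ∀ x : E3, x ≠ 0 → α (c • x) = α x) :
    ∀ x : E3, x ≠ 0 →
      ∑ i, ∑ j,
        (pd (pd (fun y => sigmaT α i j y) i) j x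
          - pd (pd (fun y => sigmaT α i i y) j) j x) = 0 := by
  intro x hx
  set ψ : E3 → ℝ := fun y => α y / ‖y‖ ^ 3 with hψ_def
  set φ : E3 → ℝ := fun y => α y / ‖y‖
  have hα' (y : E3) (hy : y ≠ 0) : ContDiffAt ℝ 2 α y := hα.contDiffAt (isOpen_ne.mem_nhds hy)
  have hψ (y : E3) (hy : y ≠ 0) : ContDiffAt ℝ 2 ψ y :=
    (hα' y hy).div ((contDiffAt_norm ℝ hy).pow 3) (pow_ne_zero 3 (norm_ne_zero_iff.mpr hy))
  have hφ (y : E3) (hy : y ≠ 0) : ContDiffAt ℝ 2 φ y :=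
    (hα' y hy).div (contDiffAt_norm ℝ hy) (norm_ne_zero_iff.mpr hy)
  have hψd (y : E3) (hy : y ≠ 0) : DifferentiableAt ℝ ψ y := (hψ y hy).differentiableAt two_ne_zero
  have hφd (y : E3) (hy : y ≠ 0) : DifferentiableAt ℝ φ y := (hφ y hy).differentiableAt two_ne_zero
  have hσ_eq (i j : Fin 3) : (fun y => sigmaT α i j y)
      = fun y => ψ y * y i * y j - (if i = j then (1 : ℝ) else 0) / 2 * φ y :=
    funext fun y => sigmaT_eq α i j y
  have hcoord (i : Fin 3) (y : E3) : ContDiffAt ℝ 2 (fun z : E3 => z i) y := by fun_prop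
  have hσ (i j : Fin 3) (y : E3) (hy : y ≠ 0) : ContDiffAt ℝ 2 (fun y => sigmaT α i j y) y := by
    rw [hσ_eq]
    exact (((hψ y hy).mul (hcoord i y)).mul (hcoord j y)).sub (contDiffAt_const.mul (hφ y hy))
  have hσd (i j : Fin 3) (y : E3) (hy : y ≠ 0) :
      DifferentiableAt ℝ (fun y => sigmaT α i j y) y := (hσ i j y hy).differentiableAt two_ne_zero
  have heuler (y : E3) (hy : y ≠ 0) : ∑ i, y i * pd ψ i y = -3 * ψ y := by
    refine euler_of_homogeneous_neg_three (hψd y hy) fun c hc => ?_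
    simp only [hψ_def, hhom c hc y hy, norm_smul, Real.norm_of_nonneg hc.le, mul_pow]
    rw [div_div, mul_comm]
  have hdiv (j : Fin 3) (y : E3) (hy : y ≠ 0) :
      ∑ i, pd (fun z => sigmaT α i j z) i y = ψ y * y j - 1 / 2 * pd φ j y := by
    have hterm (i : Fin 3) : pd (fun z => sigmaT α i j z) i y
        = pd (fun z => ψ z * z i * z j) i y - (if i = j then (1 : ℝ) else 0) / 2 * pd φ i y := by
      rw [hσ_eq, pd_sub (((hψd y hy).fun_mul (differentiable_coord i y)).fun_mul (differentiable_coord j y))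
        ((hφd y hy).const_mul _), pd_const_mul (hφd y hy)]
    simp only [hterm, Finset.sum_sub_distrib,
      sum_pd_mul_coord_mul (hψd y hy) (differentiable_coord j y) (heuler y hy), sum_mul_pd_coord]
    simp [ite_div, ite_mul]
  have hdivdiv : ∑ j, pd (fun y => ψ y * y j) j x = 0 := by
    simpa [pd] using sum_pd_mul_coord_mul (hψd x hx) (differentiableAt_const (1 : ℝ)) (heuler x hx)
  have hfirst (j : Fin 3) : ∑ i, pd (pd (fun y => sigmaT α i j y) i) j x
      = pd (fun y => ψ y * y j) j x - 1 / 2 * pd (pd φ j) j x := by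
    rw [← pd_sum fun i => differentiableAt_pd (hσ i j x hx) i, pd_congr hx (hdiv j),
      pd_sub ((hψd x hx).fun_mul (differentiable_coord j x))
        ((differentiableAt_pd (hφ x hx) j).const_mul _),
      pd_const_mul (differentiableAt_pd (hφ x hx) j)]
  have hsecond (j : Fin 3) : ∑ i, pd (pd (fun y => sigmaT α i i y) j) j x
      = -1 / 2 * pd (pd φ j) j x := by
    have htrace (y : E3) (hy : y ≠ 0) :
        ∑ i, pd (fun z => sigmaT α i i z) j y = -1 / 2 * pd φ j y := by
      rw [← pd_sum fun i => hσd i i y hy, pd_congr hy fun z hz => sum_sigmaT_diag α hz]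
      exact pd_const_mul (hφd y hy) _ j
    rw [← pd_sum fun i => differentiableAt_pd (hσ i i x hx) j, pd_congr hx htrace,
      pd_const_mul (differentiableAt_pd (hφ x hx) j)]
  rw [Finset.sum_comm]
  simp only [Finset.sum_sub_distrib, hfirst, hsecond, hdivdiv, ← Finset.mul_sum]
  ring
end
end

section
/- Let q ∈ (1/2,1), let α(x) = x₁²/r², β(x) = x₁x₃/r², σ_ij(x) = (α(x)/r)(x_i x_j/r² − δ_ij/2), τ_ij(x) = β(x) x_i x_j/r⁴, and let Y be the rotation vector field Y(x) = (x₃, 0, −x₁). Suppose that on an exterior region {|x| ≥ ρ₀} a C² Riemannian metric ḡ and a C¹ symmetric 2-tensor π̄ satisfy ḡ_ij = (1 + A/r)δ_ij + σ_ij + O₂(r^{−1−q}) and π̄_ij = τ_ij + r^{−3}(−B_i x_j − B_j x_i + (Σ_l B_l x_l)δ_ij) + O₁(r^{−2−q}) for some constants A, B₁, B₂, B₃, and that div_ḡ π̄ = 0 on {|x| ≥ ρ₀}. Then the angular momentum surface integrals with respect to Y diverge: ∫_{|x|=ρ} Σ_{i,j} π̄_ij Y^i (x_j/ρ) dS → +∞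 as ρ → ∞, where dS is the standard surface measure on the Euclidean sphere {|x| = ρ}. -/
open MeasureTheory Filter

noncomputable section

/-- Christoffel symbols `Γ^k_{ij} = (1/2) Σ_l g^{kl} (∂_j g_{il} + ∂_i g_{jl} − ∂_l g_{ij})`. -/
def Gamma (g : E3 → Matrix (Fin 3) (Fin 3) ℝ) (k i j : Fin 3) (x : E3) : ℝ :=
  (1 / 2) * ∑ l, (g x)⁻¹ k l *
    (pd (fun y => g y i l) j x + pd (fun y => g y j l) i x - pd (fun y => g y i j) l x)

/-- `(div_g π)_j = Σ_{i,k} g^{ik} (∂_i π_{kj} − Σ_l Γ^l_{ik} π_{lj} − Σ_l Γ^l_{ij} π_{kl})`. -/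
def divT (g π : E3 → Matrix (Fin 3) (Fin 3) ℝ) (j : Fin 3) (x : E3) : ℝ :=
  ∑ i, ∑ k, (g x)⁻¹ i k *
    (pd (fun y => π y k j) i x - (∑ l, Gamma g l i k x * π x l j)
      - ∑ l, Gamma g l i j x * π x k l)

/-- `f = O₁(r^{−s})` on the region `{‖x‖ ≥ ρ₀}`. -/
def IsO1 (f : E3 → ℝ) (s ρ₀ : ℝ) : Prop :=
  ∃ C : ℝ, ∀ x : E3, ρ₀ ≤ ‖x‖ →
    |f x| ≤ C * ‖x‖ ^ (-s) ∧ ∀ i, |pd f i x| ≤ C * ‖x‖ ^ (-s - 1)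

/-- `f = O₂(r^{−s})` on the region `{‖x‖ ≥ ρ₀}`. -/
def IsO2 (f : E3 → ℝ) (s ρ₀ : ℝ) : Prop :=
  ∃ C : ℝ, ∀ x : E3, ρ₀ ≤ ‖x‖ →
    |f x| ≤ C * ‖x‖ ^ (-s) ∧ (∀ i, |pd f i x| ≤ C * ‖x‖ ^ (-s - 1)) ∧
      ∀ i k, |pd (pd f i) k x| ≤ C * ‖x‖ ^ (-s - 2)

/-- The Kronecker delta. -/
def kron (i j : Fin 3) : ℝ := if i = j then 1 else 0

/-- Integral of `f` over the Euclidean sphere `{‖x‖ = ρ}` with respect to the standard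
surface measure (two-dimensional Hausdorff measure). -/
def sphereIntegral (ρ : ℝ) (f : E3 → ℝ) : ℝ :=
  ∫ x in Metric.sphere (0 : E3) ρ, f x ∂(μH[2])

/-- `α(x) = x₁²/r²`. -/
def α₅ (x : E3) : ℝ := (x 0) ^ 2 / ‖x‖ ^ 2

/-- `β(x) = x₁x₃/r²`. -/
def β₅ (x : E3) : ℝ := x 0 * x 2 / ‖x‖ ^ 2

/-- The rotation vector field `Y = x₃∂₁ − x₁∂₃`, i.e. `Y(x) = (x₃, 0, −x₁)`. -/
def Yrot (i : Fin 3) (x : E3) : ℝ :=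
  if i = 0 then x 2 else if i = 2 then -(x 0) else 0

/-- The two-dimensional Hausdorff measure on the unit sphere of `ℝ³`. -/
def sphereMeasure : Measure E3 := (μH[2] : Measure E3).restrict (Metric.sphere 0 1)

theorem ae_norm_eq_one_sphereMeasure : ∀ᵐ ω ∂sphereMeasure, ‖ω‖ = 1 := by
  have := ae_restrict_mem (μ := (μH[2] : Measure E3))
    (Metric.isClosed_sphere (x := (0 : E3)) (ε := 1)).measurableSet
  filter_upwards [this] with ω hω
  simpa using hω

theorem sphere_subset_image_spherical_coordinates :
    Metric.sphere (0 : E3) 1 ⊆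
      (fun p : Fin 2 → ℝ => (!₂[Real.cos (p 0) * Real.cos (p 1), Real.cos (p 0) * Real.sin (p 1),
        Real.sin (p 0)] : E3)) '' Set.Icc (fun _ => -Real.pi) (fun _ => Real.pi) := by
  intro x hx
  have hx1 : ‖x‖ = 1 := by simpa using hx
  have hs : x 0 ^ 2 + x 1 ^ 2 + x 2 ^ 2 = 1 := by
    have := EuclideanSpace.real_norm_sq_eq x
    rw [hx1, Fin.sum_univ_three] at this
    linarith
  have h2 : -1 ≤ x 2 ∧ x 2 ≤ 1 := abs_le.1 (abs_le_one_iff_mul_self_le_one.2 (by nlinarith))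
  have hnorm : ‖(⟨x 0, x 1⟩ : ℂ)‖ = Real.cos (Real.arcsin (x 2)) := by
    rw [Real.cos_arcsin, Complex.norm_def, Complex.normSq_mk]
    congr 1
    linarith
  refine ⟨![Real.arcsin (x 2), Complex.arg ⟨x 0, x 1⟩], ⟨?_, ?_⟩, ?_⟩
  · intro i
    fin_cases i
    · have := Real.neg_pi_div_two_le_arcsin (x 2)
      have := Real.pi_pos
      simp; linarith
    · simpa using (Complex.neg_pi_lt_arg _).le
  · intro i
    fin_cases i
    · have := Real.arcsin_le_pi_div_two (x 2)
      have := Real.pi_pos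
      simp; linarith
    · simpa using Complex.arg_le_pi _
  · ext i
    fin_cases i
    · simp [← hnorm, Complex.norm_mul_cos_arg]
    · simp [← hnorm, Complex.norm_mul_sin_arg]
    · simp [Real.sin_arcsin h2.1 h2.2]

instance isFiniteMeasure_sphereMeasure : IsFiniteMeasure sphereMeasure := by
  refine ⟨?_⟩
  rw [sphereMeasure, Measure.restrict_apply_univ]
  refine (measure_mono sphere_subset_image_spherical_coordinates).trans_lt ?_
  have hc : ContDiff ℝ 1 (fun p : Fin 2 → ℝ => (!₂[Real.cos (p 0) * Real.cos (p 1),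
      Real.cos (p 0) * Real.sin (p 1), Real.sin (p 0)] : E3)) := by
    rw [contDiff_euclidean]
    intro i
    fin_cases i <;> simp <;> fun_prop
  obtain ⟨K, hK⟩ := LocallyLipschitzOn.exists_lipschitzOnWith_of_compact
    (isCompact_Icc (a := fun _ : Fin 2 => -Real.pi) (b := fun _ => Real.pi))
    hc.locallyLipschitz.locallyLipschitzOn
  refine (hK.hausdorffMeasure_image_le (by norm_num : (0 : ℝ) ≤ 2)).trans_lt ?_
  have : (μH[2] : Measure (Fin 2 → ℝ)) = volume := by
    simpa using hausdorffMeasure_pi_real (ι := Fin 2)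
  rw [this]
  exact ENNReal.mul_lt_top (by simp) isCompact_Icc.measure_lt_top

/-- The unit sphere charges the complement of two coordinate planes. -/
theorem hausdorffMeasure_sphere_inter_pos :
    0 < (μH[2] : Measure E3) ({x | x 0 * x 2 ≠ 0} ∩ Metric.sphere 0 1) := by
  have hLip : LipschitzWith 1 (fun x : E3 => (![x 0, x 2] : Fin 2 → ℝ)) := by
    refine LipschitzWith.of_dist_le_mul fun x y => ?_
    rw [NNReal.coe_one, one_mul, dist_pi_le_iff dist_nonneg]
    intro i
    have h : ∀ j, dist (x j) (y j) ≤ dist x y := fun j => by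
      rw [dist_eq_norm, dist_eq_norm]
      exact PiLp.norm_apply_le (x - y) j
    fin_cases i
    · simpa using h 0
    · simpa using h 2
  have h1 := hLip.hausdorffMeasure_image_le (d := 2) (by norm_num)
    ({x | x 0 * x 2 ≠ 0} ∩ Metric.sphere 0 1)
  have h2 : (μH[2] : Measure (Fin 2 → ℝ)) = volume := by
    simpa using hausdorffMeasure_pi_real (ι := Fin 2)
  rw [h2] at h1
  simp only [ENNReal.coe_one, ENNReal.one_rpow, one_mul] at h1
  refine lt_of_lt_of_le ?_ h1
  have hsub : Set.Icc (fun _ : Fin 2 => (1 / 4 : ℝ)) (fun _ => 1 / 2) ⊆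
      (fun x : E3 => (![x 0, x 2] : Fin 2 → ℝ)) '' ({x | x 0 * x 2 ≠ 0} ∩ Metric.sphere 0 1) := by
    intro p hp
    have h0 : 1 / 4 ≤ p 0 ∧ p 0 ≤ 1 / 2 := ⟨hp.1 0, hp.2 0⟩
    have h1 : 1 / 4 ≤ p 1 ∧ p 1 ≤ 1 / 2 := ⟨hp.1 1, hp.2 1⟩
    refine ⟨!₂[p 0, √(1 - p 0 ^ 2 - p 1 ^ 2), p 1], ⟨?_, ?_⟩, ?_⟩
    · have : 0 < p 0 * p 1 := mul_pos (by linarith) (by linarith)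
      simpa using this.ne'
    · rw [mem_sphere_zero_iff_norm, ← pow_eq_one_iff_of_nonneg (norm_nonneg _) two_ne_zero,
        EuclideanSpace.real_norm_sq_eq, Fin.sum_univ_three]
      simp
      rw [Real.sq_sqrt (by nlinarith)]
      ring
    · ext i
      fin_cases i <;> simp
  refine lt_of_lt_of_le ?_ (measure_mono hsub)
  rw [Real.volume_Icc_pi]
  norm_num
  exact ENNReal.pow_pos (ENNReal.ofReal_pos.2 (by norm_num)) 2

theorem measurePreserving_sphereMeasure (L : E3 ≃ₗᵢ[ℝ] E3) :
    MeasurePreserving L sphereMeasure sphereMeasure := by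
  have h := (L.toIsometryEquiv.measurePreserving_hausdorffMeasure 2).restrict_preimage
    (Metric.isClosed_sphere (x := (0 : E3)) (ε := 1)).measurableSet
  have hp : L.toIsometryEquiv ⁻¹' (Metric.sphere (0 : E3) 1) = Metric.sphere 0 1 := by
    ext x; simp
  rw [hp] at h
  exact h

theorem integral_comp_isometry_sphereMeasure (L : E3 ≃ₗᵢ[ℝ] E3) (f : E3 → ℝ) :
    ∫ ω, f (L ω) ∂sphereMeasure = ∫ ω, f ω ∂sphereMeasure :=
  (measurePreserving_sphereMeasure L).integral_comp L.toHomeomorph.measurableEmbedding f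

theorem sphereIntegral_eq_integral_sphereMeasure {ρ : ℝ} (hρ : 0 < ρ) (f : E3 → ℝ) :
    sphereIntegral ρ f = ∫ ω, ρ ^ 2 * f (ρ • ω) ∂sphereMeasure := by
  have hemb : MeasurableEmbedding (fun x : E3 => ρ • x) :=
    (Homeomorph.smulOfNeZero ρ hρ.ne').measurableEmbedding
  have hmap : Measure.map (fun x : E3 => ρ • x) (μH[2] : Measure E3)
      = ENNReal.ofReal (ρ⁻¹ ^ 2) • (μH[2] : Measure E3) := by
    ext s hs
    rw [hemb.map_apply, Set.preimage_smul₀ hρ.ne',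
      Measure.hausdorffMeasure_smul₀ (by norm_num) (inv_ne_zero hρ.ne')]
    simp only [Measure.smul_apply, ENNReal.smul_def, smul_eq_mul]
    congr 1
    rw [ENNReal.ofReal, ENNReal.coe_inj]
    ext
    rw [Real.coe_toNNReal _ (by positivity)]
    simp [abs_of_pos hρ]
  have hpre : (fun x : E3 => ρ • x) ⁻¹' Metric.sphere 0 ρ = Metric.sphere 0 1 := by
    ext x
    simp only [Set.mem_preimage, mem_sphere_zero_iff_norm, norm_smul, Real.norm_of_nonneg hρ.le]
    constructor
    · intro h; exact mul_left_cancel₀ hρ.ne' (by linarith)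
    · intro h; rw [h, mul_one]
  have h := hemb.setIntegral_map (μ := (μH[2] : Measure E3)) f (Metric.sphere 0 ρ)
  rw [hmap, hpre, Measure.restrict_smul, integral_smul_measure,
    ENNReal.toReal_ofReal (by positivity), smul_eq_mul] at h
  rw [integral_const_mul, sphereMeasure, ← h, sphereIntegral]
  field_simp

theorem integrable_sphereMeasure {f : E3 → ℝ} (hf : ContinuousOn f (Metric.sphere 0 1)) :
    Integrable f sphereMeasure :=
  have : IsFiniteMeasure ((μH[2] : Measure E3).restrict (Metric.sphere 0 1)) :=
    isFiniteMeasure_sphereMeasure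
  have hfin : (μH[2] : Measure E3) (Metric.sphere 0 1) ≠ ⊤ := by
    simpa using measure_ne_top ((μH[2] : Measure E3).restrict (Metric.sphere 0 1)) Set.univ
  hf.integrableOn_of_subset_isCompact (isCompact_sphere 0 1)
    Metric.isClosed_sphere.measurableSet subset_rfl hfin

theorem hasDerivAt_integral_sphereMeasure {F F' : ℝ → E3 → ℝ} {s : Set ℝ} {t₀ : ℝ}
    (hs : s ∈ nhds t₀)
    (hF : ∀ t ∈ s, ContinuousOn (F t) (Metric.sphere 0 1))
    (hF' : ContinuousOn (Function.uncurry F') (s ×ˢ Metric.sphere 0 1))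
    (hd : ∀ ω ∈ Metric.sphere (0 : E3) 1, ∀ t ∈ s, HasDerivAt (F · ω) (F' t ω) t) :
    HasDerivAt (fun t => ∫ ω, F t ω ∂sphereMeasure) (∫ ω, F' t₀ ω ∂sphereMeasure) t₀ := by
  obtain ⟨ε, hε, hball⟩ := Metric.nhds_basis_closedBall.mem_iff.1 hs
  obtain ⟨C, hC⟩ := ((isCompact_closedBall t₀ ε).prod
    (isCompact_sphere (0 : E3) 1)).exists_bound_of_continuousOn
    (hF'.mono (Set.prod_mono hball subset_rfl))
  have h₀ : t₀ ∈ s := mem_of_mem_nhds hs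
  have hF'₀ : ContinuousOn (F' t₀) (Metric.sphere 0 1) :=
    hF'.comp (by fun_prop : ContinuousOn (fun ω : E3 => (t₀, ω)) (Metric.sphere 0 1))
      fun ω hω => ⟨h₀, hω⟩
  have hae := ae_norm_eq_one_sphereMeasure
  refine (hasDerivAt_integral_of_dominated_loc_of_deriv_le
    (Metric.closedBall_mem_nhds t₀ hε) ?_ (integrable_sphereMeasure (hF t₀ h₀))
    (integrable_sphereMeasure hF'₀).aestronglyMeasurable (bound := fun _ => C) ?_
    (integrable_const C) ?_).2
  · filter_upwards [hs] with t ht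
    exact (integrable_sphereMeasure (hF t ht)).aestronglyMeasurable
  · filter_upwards [hae] with ω hω t ht
    exact hC (t, ω) ⟨ht, by simpa using hω⟩
  · filter_upwards [hae] with ω hω t ht
    exact hd ω (by simpa using hω) t (hball ht)

/-- The rotation by the angle `t` in the plane of the coordinates `i` and `j`. -/
def planeRotation (i j : Fin 3) (t : ℝ) : E3 →ₗ[ℝ] E3 where
  toFun x := x + ((Real.cos t - 1) * x i - Real.sin t * x j) • EuclideanSpace.single i (1 : ℝ)
    + (Real.sin t * x i + (Real.cos t - 1) * x j) • EuclideanSpace.single j (1 : ℝ)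
  map_add' x y := by
    ext k; simp; split_ifs <;> ring
  map_smul' c x := by
    ext k; simp; split_ifs <;> ring

theorem planeRotation_apply (i j : Fin 3) (t : ℝ) (x : E3) : planeRotation i j t x =
    x + ((Real.cos t - 1) * x i - Real.sin t * x j) • EuclideanSpace.single i (1 : ℝ)
    + (Real.sin t * x i + (Real.cos t - 1) * x j) • EuclideanSpace.single j (1 : ℝ) := rfl

theorem norm_planeRotation {i j : Fin 3} (hij : i ≠ j) (t : ℝ) (x : E3) :
    ‖planeRotation i j t x‖ = ‖x‖ := by
  rw [← sq_eq_sq₀ (norm_nonneg _) (norm_nonneg _), EuclideanSpace.real_norm_sq_eq,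
    EuclideanSpace.real_norm_sq_eq, Fin.sum_univ_three, Fin.sum_univ_three]
  have h := Real.sin_sq_add_cos_sq t
  have hs : Real.sin t ^ 2 = 1 - Real.cos t ^ 2 := by linarith
  fin_cases i <;> fin_cases j <;> first | exact absurd rfl hij | skip
  all_goals
    simp [planeRotation_apply]
    ring_nf
    rw [hs]
    ring

/-- `planeRotation` as a linear isometry equivalence. -/
def planeRotationEquiv {i j : Fin 3} (hij : i ≠ j) (t : ℝ) : E3 ≃ₗᵢ[ℝ] E3 :=
  LinearIsometry.toLinearIsometryEquiv ⟨planeRotation i j t, norm_planeRotation hij t⟩ rfl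

/-- The integral over the sphere of the derivative along a rotation field vanishes. -/
theorem integral_rotation_deriv_eq_zero {U : Set E3} (hU : IsOpen U)
    (hSU : Metric.sphere 0 1 ⊆ U) {f : E3 → ℝ} (hf : ContDiffOn ℝ 1 f U) (i j : Fin 3) :
    ∫ ω, (ω i * pd f j ω - ω j * pd f i ω) ∂sphereMeasure = 0 := by
  rcases eq_or_ne i j with rfl | hij
  · simp
  have hdf : ∀ x ∈ U, HasFDerivAt f (fderiv ℝ f x) x := fun x hx =>
    ((hf.differentiableOn one_ne_zero).differentiableAt (hU.mem_nhds hx)).hasFDerivAt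
  have hcf : ContinuousOn (fderiv ℝ f) U := hf.continuousOn_fderiv_of_isOpen hU le_rfl
  have hrot : ∀ t, ∀ ω ∈ Metric.sphere (0 : E3) 1, planeRotation i j t ω ∈ U := fun t ω hω =>
    hSU (by simpa [norm_planeRotation hij] using hω)
  set R : ℝ → E3 → E3 := fun t x =>
    (-Real.sin t * x i - Real.cos t * x j) • EuclideanSpace.single i (1 : ℝ)
    + (Real.cos t * x i - Real.sin t * x j) • EuclideanSpace.single j (1 : ℝ) with hR
  have hcont : Continuous fun p : ℝ × E3 => planeRotation i j p.1 p.2 := by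
    simp only [planeRotation_apply]
    fun_prop
  have key := hasDerivAt_integral_sphereMeasure (F := fun t ω => f (planeRotation i j t ω))
    (F' := fun t ω => fderiv ℝ f (planeRotation i j t ω) (R t ω)) (t₀ := 0) univ_mem
    ?_ ?_ ?_
  · have hconst : (fun t : ℝ => ∫ ω, f (planeRotation i j t ω) ∂sphereMeasure)
        = fun _ => ∫ ω, f ω ∂sphereMeasure := by
      funext t
      exact integral_comp_isometry_sphereMeasure (planeRotationEquiv hij t) f
    rw [hconst] at key
    rw [← key.unique (hasDerivAt_const _ _)]
    congr 1
    funext ω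
    simp [hR, planeRotation_apply, pd]
    ring
  · intro t _
    exact hf.continuousOn.comp
      (hcont.comp (by fun_prop : Continuous fun ω : E3 => (t, ω))).continuousOn (hrot t)
  · have h1 : ContinuousOn (fun p : ℝ × E3 => fderiv ℝ f (planeRotation i j p.1 p.2))
        (Set.univ ×ˢ Metric.sphere 0 1) :=
      hcf.comp hcont.continuousOn fun p hp => hrot p.1 p.2 hp.2
    have h2 : Continuous fun p : ℝ × E3 => R p.1 p.2 := by
      simp only [hR]
      fun_prop
    exact h1.clm_apply h2.continuousOn
  · intro ω hω t _
    refine (hdf _ (hrot t ω hω)).comp_hasDerivAt t ?_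
    simp only [planeRotation_apply, hR]
    refine HasDerivAt.add ?_ (HasDerivAt.smul_const ?_ _)
    · refine HasDerivAt.const_add _ (HasDerivAt.smul_const ?_ _)
      exact (((Real.hasDerivAt_cos t).sub_const 1).mul_const _).sub
        ((Real.hasDerivAt_sin t).mul_const _)
    · exact (((Real.hasDerivAt_sin t).mul_const (ω i)).fun_add
        (((Real.hasDerivAt_cos t).sub_const 1).mul_const (ω j))).congr_deriv (by ring)

theorem fderiv_apply_eq_sum_pd (f : E3 → ℝ) (x v : E3) :
    fderiv ℝ f x v = ∑ k, v k * pd f k x := by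
  conv_lhs => rw [← (EuclideanSpace.basisFun (Fin 3) ℝ).sum_repr v]
  simp [pd]

theorem continuousOn_pd {U : Set E3} (hU : IsOpen U) {f : E3 → ℝ} (hf : ContDiffOn ℝ 1 f U)
    (i : Fin 3) : ContinuousOn (pd f i) U :=
  (hf.continuousOn_fderiv_of_isOpen hU le_rfl).clm_apply continuousOn_const

/-- The derivative in the radius of the flux of a vector field through spheres is the
integral of its divergence. -/
theorem hasDerivAt_flux {ρ₀ : ℝ} (hρ₀ : 0 < ρ₀) {V : Fin 3 → E3 → ℝ}
    (hV : ∀ i, ContDiffOn ℝ 1 (V i) {x : E3 | ρ₀ < ‖x‖}) {R : ℝ} (hR : ρ₀ < R) :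
    HasDerivAt (fun ρ => ∫ ω, ρ ^ 2 * ∑ i, V i (ρ • ω) * ω i ∂sphereMeasure)
      (∫ ω, R ^ 2 * ∑ i, pd (V i) i (R • ω) ∂sphereMeasure) R := by
  have hUo : IsOpen {x : E3 | ρ₀ < ‖x‖} := isOpen_lt continuous_const continuous_norm
  have hd : ∀ i, ∀ x : E3, ρ₀ < ‖x‖ → HasFDerivAt (V i) (fderiv ℝ (V i) x) x := fun i x hx =>
    (((hV i).differentiableOn one_ne_zero).differentiableAt (hUo.mem_nhds hx)).hasFDerivAt
  have hmem : ∀ t ∈ Set.Ioi ρ₀, ∀ ω ∈ Metric.sphere (0 : E3) 1, ρ₀ < ‖t • ω‖ := by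
    intro t ht ω hω
    rw [norm_smul, mem_sphere_zero_iff_norm.1 hω, mul_one, Real.norm_of_nonneg (hρ₀.trans ht).le]
    exact ht
  have hcontV : ∀ t ∈ Set.Ioi ρ₀, ∀ i, ContinuousOn (fun ω => V i (t • ω)) (Metric.sphere 0 1) :=
    fun t ht i => (hV i).continuousOn.comp (by fun_prop) (hmem t ht)
  have hcontpd : ∀ t ∈ Set.Ioi ρ₀, ∀ i k,
      ContinuousOn (fun ω => pd (V i) k (t • ω)) (Metric.sphere 0 1) :=
    fun t ht i k => (continuousOn_pd hUo (hV i) k).comp (by fun_prop) (hmem t ht)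
  have key := hasDerivAt_integral_sphereMeasure
    (F := fun ρ ω => ρ ^ 2 * ∑ i, V i (ρ • ω) * ω i)
    (F' := fun ρ ω => 2 * ρ * (∑ i, V i (ρ • ω) * ω i)
      + ρ ^ 2 * ∑ i, (∑ k, ω k * pd (V i) k (ρ • ω)) * ω i) (t₀ := R) (Ioi_mem_nhds hR) ?_ ?_ ?_
  · convert key using 1
    have hrot : ∀ i j : Fin 3, ∫ ω, (ω i * pd (fun x => x i * V j (R • x)) j ω
        - ω j * pd (fun x => x i * V j (R • x)) i ω) ∂sphereMeasure = 0 := by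
      intro i j
      refine integral_rotation_deriv_eq_zero (U := {x : E3 | ρ₀ < ‖R • x‖})
        (isOpen_lt continuous_const (by fun_prop)) (hmem R hR) ?_ i j
      refine ContDiffOn.mul (by fun_prop) ((hV j).comp (by fun_prop) fun x hx => hx)
    have hpd : ∀ ω ∈ Metric.sphere (0 : E3) 1, ∀ i j k : Fin 3,
        pd (fun x => x i * V j (R • x)) k ω
          = (if i = k then V j (R • ω) else 0) + ω i * (R * pd (V j) k (R • ω)) := by
      intro ω hω i j k
      have h1 : HasFDerivAt (fun x : E3 => x i) (EuclideanSpace.proj i : E3 →L[ℝ] ℝ) ω :=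
        (EuclideanSpace.proj i : E3 →L[ℝ] ℝ).hasFDerivAt
      have h2 : HasFDerivAt (fun x : E3 => R • x) (R • ContinuousLinearMap.id ℝ E3) ω :=
        (hasFDerivAt_id ω).const_smul R
      have h3 := h1.mul ((hd j (R • ω) (hmem R hR ω hω)).comp ω h2)
      rw [pd, show fderiv ℝ (fun x : E3 => x i * V j (R • x)) ω = _ from h3.fderiv]
      simp [pd, eq_comm (a := i)]
      split_ifs <;> ring
    have hint : ∀ i j : Fin 3, Integrable (fun ω => R * (ω i * pd (fun x => x i * V j (R • x)) j ω
        - ω j * pd (fun x => x i * V j (R • x)) i ω)) sphereMeasure := by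
      intro i j
      refine integrable_sphereMeasure (ContinuousOn.congr (f := fun ω => R * (ω i *
        ((if i = j then V j (R • ω) else 0) + ω i * (R * pd (V j) j (R • ω)))
        - ω j * (V j (R • ω) + ω i * (R * pd (V j) i (R • ω))))) ?_ ?_)
      · have h1 := hcontV R hR j
        have h2 := hcontpd R hR j
        have h3 : ∀ k : Fin 3, ContinuousOn (fun ω : E3 => ω k) (Metric.sphere 0 1) :=
          fun k => by fun_prop
        refine continuousOn_const.mul (((h3 i).mul (ContinuousOn.add ?_
          ((h3 i).mul (continuousOn_const.mul (h2 j))))).sub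
          ((h3 j).mul (h1.add ((h3 i).mul (continuousOn_const.mul (h2 i))))))
        split_ifs
        · exact h1
        · exact continuousOn_const
      · intro ω hω
        simp only [hpd ω hω, if_true]
    have hzero : ∫ ω, ∑ i : Fin 3, ∑ j : Fin 3, R * (ω i * pd (fun x => x i * V j (R • x)) j ω
        - ω j * pd (fun x => x i * V j (R • x)) i ω) ∂sphereMeasure = 0 := by
      rw [integral_finsetSum _ fun i _ => integrable_finsetSum _ fun j _ => hint i j]
      refine Finset.sum_eq_zero fun i _ => ?_
      rw [integral_finsetSum _ fun j _ => hint i j]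
      refine Finset.sum_eq_zero fun j _ => ?_
      rw [integral_const_mul, hrot, mul_zero]
    rw [← sub_eq_zero, ← integral_sub, ← hzero]
    · refine integral_congr_ae ?_
      filter_upwards [ae_norm_eq_one_sphereMeasure] with ω hω
      have hS : ω ∈ Metric.sphere (0 : E3) 1 := by simpa using hω
      have hs : ω 0 ^ 2 = 1 - ω 1 ^ 2 - ω 2 ^ 2 := by
        have := EuclideanSpace.real_norm_sq_eq ω
        rw [hω, Fin.sum_univ_three] at this
        linarith
      simp only [hpd ω hS, Fin.sum_univ_three]
      simp
      ring_nf
      rw [hs]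
      ring
    · refine integrable_sphereMeasure (continuousOn_const.mul
        (continuousOn_finsetSum _ fun i _ => hcontpd R hR i i))
    · refine integrable_sphereMeasure (ContinuousOn.add (continuousOn_const.mul
        (continuousOn_finsetSum _ fun i _ => (hcontV R hR i).mul (by fun_prop)))
        (continuousOn_const.mul (continuousOn_finsetSum _ fun i _ =>
          ContinuousOn.mul (continuousOn_finsetSum _ fun k _ =>
            ContinuousOn.mul (by fun_prop) (hcontpd R hR i k)) (by fun_prop))))
  · intro t ht
    exact continuousOn_const.mul
      (continuousOn_finsetSum _ fun i _ => (hcontV t ht i).mul (by fun_prop))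
  · have hsm : ContinuousOn (fun p : ℝ × E3 => p.1 • p.2) (Set.Ioi ρ₀ ×ˢ Metric.sphere 0 1) := by
      fun_prop
    have h1 : ∀ i, ContinuousOn (fun p : ℝ × E3 => V i (p.1 • p.2))
        (Set.Ioi ρ₀ ×ˢ Metric.sphere 0 1) := fun i =>
      (hV i).continuousOn.comp hsm fun p hp => hmem p.1 hp.1 p.2 hp.2
    have h2 : ∀ i k, ContinuousOn (fun p : ℝ × E3 => pd (V i) k (p.1 • p.2))
        (Set.Ioi ρ₀ ×ˢ Metric.sphere 0 1) := fun i k =>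
      (continuousOn_pd hUo (hV i) k).comp hsm fun p hp => hmem p.1 hp.1 p.2 hp.2
    simp only [Function.uncurry_def]
    exact (ContinuousOn.mul (by fun_prop) (continuousOn_finsetSum _ fun i _ =>
      (h1 i).mul (by fun_prop))).add (ContinuousOn.mul (by fun_prop)
      (continuousOn_finsetSum _ fun i _ => (continuousOn_finsetSum _ fun k _ =>
        ContinuousOn.mul (by fun_prop) (h2 i k)).mul (by fun_prop)))
  · intro ω hω t ht
    have hline : HasDerivAt (fun s : ℝ => s • ω) ω t := by
      simpa using (hasDerivAt_id t).smul_const ω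
    have hVi : ∀ i, HasDerivAt (fun s : ℝ => V i (s • ω) * ω i)
        ((∑ k, ω k * pd (V i) k (t • ω)) * ω i) t := fun i => by
      rw [← fderiv_apply_eq_sum_pd]
      exact ((hd i _ (hmem t ht ω hω)).comp_hasDerivAt t hline).mul_const _
    have := (hasDerivAt_pow 2 t).fun_mul (HasDerivAt.fun_sum fun i (_ : i ∈ Finset.univ) => hVi i)
    simpa using this

/-- `f = O(r^s)` at infinity. -/
def GrowsLike (f : E3 → ℝ) (s : ℝ) : Prop :=
  f =O[Bornology.cobounded E3] fun x => ‖x‖ ^ s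

theorem eventually_lt_norm_cobounded (R : ℝ) : ∀ᶠ x in Bornology.cobounded E3, R < ‖x‖ :=
  tendsto_norm_cobounded_atTop.eventually_gt_atTop R

namespace GrowsLike

variable {f g : E3 → ℝ} {s t : ℝ}

theorem mul (hf : GrowsLike f s) (hg : GrowsLike g t) :
    GrowsLike (fun x => f x * g x) (s + t) := by
  refine (Asymptotics.IsBigO.mul hf hg).congr' EventuallyEq.rfl ?_
  filter_upwards [eventually_lt_norm_cobounded 0] with x hx
  exact (Real.rpow_add hx s t).symm

theorem add (hf : GrowsLike f s) (hg : GrowsLike g s) : GrowsLike (fun x => f x + g x) s :=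
  Asymptotics.IsBigO.add hf hg

theorem sub (hf : GrowsLike f s) (hg : GrowsLike g s) : GrowsLike (fun x => f x - g x) s :=
  Asymptotics.IsBigO.sub hf hg

theorem neg (hf : GrowsLike f s) : GrowsLike (fun x => -f x) s :=
  Asymptotics.IsBigO.neg_left hf

theorem const_mul (hf : GrowsLike f s) (c : ℝ) : GrowsLike (fun x => c * f x) s :=
  Asymptotics.IsBigO.const_mul_left hf c

theorem sum {ι : Type*} {F : ι → E3 → ℝ} {u : Finset ι} (hF : ∀ i ∈ u, GrowsLike (F i) s) :
    GrowsLike (fun x => ∑ i ∈ u, F i x) s :=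
  Asymptotics.IsBigO.fun_sum hF

theorem mono (hf : GrowsLike f s) (hst : s ≤ t) : GrowsLike f t := by
  refine Asymptotics.IsBigO.trans hf (Asymptotics.IsBigO.of_bound 1 ?_)
  filter_upwards [eventually_lt_norm_cobounded 1] with x hx
  rw [one_mul, Real.norm_of_nonneg (by positivity), Real.norm_of_nonneg (by positivity)]
  exact Real.rpow_le_rpow_of_exponent_le hx.le hst

theorem congr (hf : GrowsLike f s) (h : ∀ᶠ x in Bornology.cobounded E3, f x = g x) :
    GrowsLike g s :=
  Asymptotics.IsBigO.congr' hf h EventuallyEq.rfl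

theorem of_bound {C ρ₀ : ℝ} (h : ∀ x : E3, ρ₀ ≤ ‖x‖ → |f x| ≤ C * ‖x‖ ^ s) : GrowsLike f s := by
  refine Asymptotics.IsBigO.of_bound C ?_
  filter_upwards [eventually_lt_norm_cobounded ρ₀] with x hx
  rw [Real.norm_of_nonneg (r := ‖x‖ ^ s) (by positivity)]
  exact h x hx.le

theorem exists_bound (hf : GrowsLike f s) :
    ∃ C R : ℝ, 0 < C ∧ ∀ x : E3, R ≤ ‖x‖ → |f x| ≤ C * ‖x‖ ^ s := by
  obtain ⟨C, hC, h⟩ := Asymptotics.IsBigO.exists_pos hf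
  have h := h.bound
  rw [← comap_norm_atTop, eventually_comap] at h
  obtain ⟨R, hR⟩ := eventually_atTop.1 h
  refine ⟨C, R, hC, fun x hx => ?_⟩
  have := hR ‖x‖ hx x rfl
  rwa [Real.norm_of_nonneg (r := ‖x‖ ^ s) (by positivity)] at this

theorem const (c : ℝ) : GrowsLike (fun _ => c) 0 := by
  simpa [GrowsLike] using Asymptotics.isBigO_const_const c (one_ne_zero (α := ℝ))
    (Bornology.cobounded E3)

theorem coord (i : Fin 3) : GrowsLike (fun x => x i) 1 := by
  refine of_bound (C := 1) (ρ₀ := 0) fun x _ => ?_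
  rw [Real.rpow_one, one_mul]
  exact PiLp.norm_apply_le x i

theorem tendsto_zero (hf : GrowsLike f s) (hs : s < 0) :
    Tendsto f (Bornology.cobounded E3) (nhds 0) := by
  refine Asymptotics.IsBigO.trans_tendsto hf ?_
  have := (tendsto_rpow_neg_atTop (neg_pos.2 hs)).comp
    (tendsto_norm_cobounded_atTop (E := E3))
  simpa [Function.comp_def] using this

end GrowsLike

theorem growsLike_Yrot (i : Fin 3) : GrowsLike (Yrot i) 1 := by
  fin_cases i
  · exact GrowsLike.coord 2
  · exact (GrowsLike.const 0).mono (by norm_num)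
  · exact (GrowsLike.coord 0).neg

/-- A function homogeneous of degree `-k` and its derivatives decay accordingly. -/
theorem growsLike_of_homogeneous {f : E3 → ℝ} (hf : ContDiffOn ℝ 1 f {0}ᶜ) {k : ℕ}
    (hhom : ∀ t : ℝ, 0 < t → ∀ x : E3, x ≠ 0 → t ^ k * f (t • x) = f x) :
    GrowsLike f (-k) ∧ ∀ i, GrowsLike (pd f i) (-k - 1) := by
  have hopen : IsOpen ({0}ᶜ : Set E3) := isOpen_compl_singleton
  have hS : Metric.sphere (0 : E3) 1 ⊆ {0}ᶜ := by
    rintro x hx rfl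
    simp at hx
  have hbound : ∀ (h : E3 → ℝ) (m : ℕ), ContinuousOn h {0}ᶜ →
      (∀ t : ℝ, 0 < t → ∀ x : E3, x ≠ 0 → t ^ m * h (t • x) = h x) → GrowsLike h (-m) := by
    intro h m hc hh
    obtain ⟨C, hC⟩ := (isCompact_sphere (0 : E3) 1).exists_bound_of_continuousOn (hc.mono hS)
    refine GrowsLike.of_bound (C := C) (ρ₀ := 1) fun x hx => ?_
    have hx0 : 0 < ‖x‖ := one_pos.trans_le hx
    have hne : x ≠ 0 := norm_pos_iff.1 hx0
    have hu : ‖‖x‖⁻¹ • x‖ = 1 := by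
      rw [norm_smul, norm_inv, norm_norm, inv_mul_cancel₀ hx0.ne']
    have h1 := hh ‖x‖⁻¹ (inv_pos.2 hx0) x hne
    rw [← h1, abs_mul, abs_of_nonneg (by positivity), Real.rpow_neg hx0.le, Real.rpow_natCast,
      inv_pow, mul_comm]
    exact mul_le_mul_of_nonneg_right (hC _ (by simpa using hu)) (by positivity)
  refine ⟨hbound f k hf.continuousOn hhom, fun i => ?_⟩
  have := hbound (pd f i) (k + 1) (continuousOn_pd hopen hf i) ?_
  · convert this using 1
    push_cast; ring
  · intro t ht x hx
    have htx : t • x ≠ 0 := smul_ne_zero ht.ne' hx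
    have hd : HasFDerivAt f (fderiv ℝ f (t • x)) (t • x) :=
      ((hf.differentiableOn one_ne_zero).differentiableAt (hopen.mem_nhds htx)).hasFDerivAt
    have h1 : HasFDerivAt (fun y : E3 => t ^ k * f (t • y))
        (t ^ k • (fderiv ℝ f (t • x)).comp (t • ContinuousLinearMap.id ℝ E3)) x :=
      (hd.comp x ((hasFDerivAt_id x).const_smul t)).const_mul _
    have h2 : (fun y : E3 => t ^ k * f (t • y)) =ᶠ[nhds x] f := by
      filter_upwards [hopen.mem_nhds hx] with y hy
      exact hhom t ht y hy
    have h3 := (h1.congr_of_eventuallyEq h2.symm).fderiv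
    rw [pd, pd, h3]
    simp
    ring

/-- `f` is differentiable at `x` and its `i`-th partial derivative there is `v`. -/
def HasPd (f : E3 → ℝ) (i : Fin 3) (x : E3) (v : ℝ) : Prop :=
  DifferentiableAt ℝ f x ∧ pd f i x = v

namespace HasPd

variable {f g : E3 → ℝ} {i : Fin 3} {x : E3} {v w : ℝ}

theorem add (hf : HasPd f i x v) (hg : HasPd g i x w) :
    HasPd (fun y => f y + g y) i x (v + w) := by
  refine ⟨hf.1.fun_add hg.1, ?_⟩
  rw [← hf.2, ← hg.2, pd, fderiv_fun_add hf.1 hg.1]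
  rfl

theorem sub (hf : HasPd f i x v) (hg : HasPd g i x w) :
    HasPd (fun y => f y - g y) i x (v - w) := by
  refine ⟨hf.1.fun_sub hg.1, ?_⟩
  rw [← hf.2, ← hg.2, pd, fderiv_fun_sub hf.1 hg.1]
  rfl

theorem mul (hf : HasPd f i x v) (hg : HasPd g i x w) :
    HasPd (fun y => f y * g y) i x (v * g x + f x * w) := by
  refine ⟨hf.1.fun_mul hg.1, ?_⟩
  rw [← hf.2, ← hg.2, pd, fderiv_fun_mul hf.1 hg.1]
  simp [pd]
  ring

theorem const (c : ℝ) : HasPd (fun _ => c) i x 0 :=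
  ⟨differentiableAt_const c, by simp [pd]⟩

theorem sum {ι : Type*} {F : ι → E3 → ℝ} {u : Finset ι} {v : ι → ℝ}
    (hF : ∀ k ∈ u, HasPd (F k) i x (v k)) :
    HasPd (fun y => ∑ k ∈ u, F k y) i x (∑ k ∈ u, v k) := by
  refine ⟨DifferentiableAt.fun_sum fun k hk => (hF k hk).1, ?_⟩
  rw [pd, fderiv_fun_sum fun k hk => (hF k hk).1]
  simp only [sum_apply]
  exact Finset.sum_congr rfl fun k hk => (hF k hk).2

end HasPd

/-- The constant partial derivative `∂_i Y^j` of the rotation field. -/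
def dYrot (i j : Fin 3) : ℝ :=
  if i = 2 ∧ j = 0 then 1 else if i = 0 ∧ j = 2 then -1 else 0

theorem hasPd_Yrot (i j : Fin 3) (x : E3) : HasPd (Yrot j) i x (dYrot i j) := by
  have h : ∀ k : Fin 3, HasFDerivAt (fun y : E3 => y k) (EuclideanSpace.proj k : E3 →L[ℝ] ℝ) x :=
    fun k => (EuclideanSpace.proj k : E3 →L[ℝ] ℝ).hasFDerivAt
  fin_cases j
  · have h0 : HasFDerivAt (Yrot 0) (EuclideanSpace.proj 2 : E3 →L[ℝ] ℝ) x := h 2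
    refine ⟨h0.differentiableAt, ?_⟩
    simp only [Fin.zero_eta, pd, h0.fderiv]
    fin_cases i <;> simp [dYrot]
  · have h1 : Yrot 1 = fun _ => 0 := by funext y; simp [Yrot]
    simp only [Fin.mk_one, h1]
    convert HasPd.const 0
    simp [dYrot]
  · have h0 : HasFDerivAt (Yrot 2) (-(EuclideanSpace.proj 0 : E3 →L[ℝ] ℝ)) x := (h 0).neg
    refine ⟨h0.differentiableAt, ?_⟩
    simp only [Fin.reduceFinMk, pd, h0.fderiv]
    fin_cases i <;> simp [dYrot]

/-- A matrix field asymptotic to the identity has inverse `1 - h + O(h²)`. -/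
theorem growsLike_inv {g : E3 → Matrix (Fin 3) (Fin 3) ℝ}
    (hdet : ∀ᶠ x in Bornology.cobounded E3, IsUnit (g x).det)
    (hg : ∀ i j, GrowsLike (fun x => g x i j - kron i j) (-1)) (i j : Fin 3) :
    GrowsLike (fun x => (g x)⁻¹ i j - kron i j) (-1) ∧
      GrowsLike (fun x => (g x)⁻¹ i j - kron i j + (g x i j - kron i j)) (-2) := by
  have hlim : Tendsto g (Bornology.cobounded E3) (nhds 1) := by
    refine tendsto_pi_nhds.2 fun i => tendsto_pi_nhds.2 fun j => ?_
    have := ((hg i j).tendsto_zero (by norm_num)).add_const (kron i j)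
    simpa [Matrix.one_apply, kron] using this
  have hinv : Tendsto (fun x => (g x)⁻¹) (Bornology.cobounded E3) (nhds 1) := by
    have hc : ContinuousAt (fun M : Matrix (Fin 3) (Fin 3) ℝ => M.det⁻¹ • M.adjugate) 1 := by
      exact ((Continuous.matrix_det continuous_id).continuousAt.inv₀ (by simp)).smul
        (Continuous.matrix_adjugate continuous_id).continuousAt
    have h1 := hc.tendsto.comp hlim
    simp only [Matrix.det_one, inv_one, Matrix.adjugate_one, one_smul] at h1
    refine h1.congr fun x => ?_
    simp [Matrix.inv_def]
  have hbdd : ∀ i j, GrowsLike (fun x => (g x)⁻¹ i j) 0 := fun i j => by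
    have h1 : Tendsto (fun x => (g x)⁻¹ i j) (Bornology.cobounded E3) (nhds _) :=
      tendsto_pi_nhds.1 (tendsto_pi_nhds.1 hinv i) j
    simpa [GrowsLike] using h1.isBigO_one ℝ
  have hD : ∀ i j, GrowsLike (fun x => (g x)⁻¹ i j - kron i j) (-1) := fun i j => by
    have h1 : GrowsLike (fun x => -∑ k, (g x)⁻¹ i k * (g x k j - kron k j)) (0 + -1) :=
      (GrowsLike.sum fun k _ => (hbdd i k).mul (hg k j)).neg
    rw [zero_add] at h1
    refine h1.congr ?_
    filter_upwards [hdet] with x hx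
    have h2 : ((g x)⁻¹ * g x) i j = kron i j := by
      rw [Matrix.nonsing_inv_mul _ hx, Matrix.one_apply, kron]
    rw [Matrix.mul_apply] at h2
    simp only [mul_sub, Finset.sum_sub_distrib, h2]
    simp [kron]
  refine ⟨hD i j, ?_⟩
  have h1 : GrowsLike (fun x => -∑ k, ((g x)⁻¹ i k - kron i k) * (g x k j - kron k j))
      (-1 + -1) := (GrowsLike.sum fun k _ => (hD i k).mul (hg k j)).neg
  norm_num at h1
  refine h1.congr ?_
  filter_upwards [hdet] with x hx
  have h2 : ((g x)⁻¹ * g x) i j = kron i j := by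
    rw [Matrix.nonsing_inv_mul _ hx, Matrix.one_apply, kron]
  rw [Matrix.mul_apply] at h2
  simp only [mul_sub, sub_mul, Finset.sum_sub_distrib, h2]
  simp [kron]
  ring

/-- The difference between the divergence of a symmetric tensor `P` with respect to the metric
and its linearization at the Euclidean metric, written in terms of the inverse metric `G`, the
perturbation `h`, the Christoffel symbols `Γ` and the first derivatives `d` of the metric and `p`
of the tensor. -/
theorem linearized_divergence_identity (G h P : Fin 3 → Fin 3 → ℝ)
    (Γ d p : Fin 3 → Fin 3 → Fin 3 → ℝ)
    (hP : ∀ i j, P i j = P j i) (hd : ∀ k i j, d k i j = d k j i) (j : Fin 3) :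
    (∑ i, p i i j) - (∑ i, ∑ k, h i k * p i k j)
      - (∑ i, ∑ k, (d i i k - 1 / 2 * d k i i) * P k j) - 1 / 2 * (∑ i, ∑ l, d j i l * P i l)
    = (∑ i, ∑ k, G i k * (p i k j - (∑ l, Γ l i k * P l j) - ∑ l, Γ l i j * P k l))
      - (∑ i, ∑ k, (G i k - kron i k + h i k) * p i k j)
      + (∑ i, ∑ k, ∑ l,
          (G i k * Γ l i k - kron i k * (1 / 2 * (d k i l + d i k l - d l i k))) * P l j)
      + (∑ i, ∑ k, ∑ l,
          (G i k * Γ l i j - kron i k * (1 / 2 * (d j i l + d i j l - d l i j))) * P k l) := by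
  have h1 := hP 1 0
  have h2 := hP 2 0
  have h3 := hP 2 1
  have e : ∀ k i, d k i j = d k j i := fun k i => hd k i j
  simp only [e, Fin.sum_univ_three, kron, h1, h2, h3]
  simp
  ring

/-- The contraction of `π` with the rotation field, corrected to first order in `g - δ` so that
its Euclidean divergence approximates the metric one. -/
def correctedField (g π : E3 → Matrix (Fin 3) (Fin 3) ℝ) (i : Fin 3) (x : E3) : ℝ :=
  ∑ j, (π x i j - (∑ k, (g x i k - kron i k) * π x k j)
    + (∑ m, (g x m m - kron m m)) * (1 / 2 * π x i j)) * Yrot j x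

/-- Half the contraction of `π` with the Lie derivative of `g` along the rotation field. -/
def lieContraction (g π : E3 → Matrix (Fin 3) (Fin 3) ℝ) (x : E3) : ℝ :=
  1 / 2 * (∑ i, ∑ l, (∑ j, Yrot j x * pd (fun y => g y i l) j x) * π x i l)
    + ∑ k, ((g x 0 k - kron 0 k) * π x k 2 - (g x 2 k - kron 2 k) * π x k 0)

theorem hasPd_correctedField {g π : E3 → Matrix (Fin 3) (Fin 3) ℝ} {x : E3}
    (hg : ∀ i j, DifferentiableAt ℝ (fun y => g y i j) x)
    (hπ : ∀ i j, DifferentiableAt ℝ (fun y => π y i j) x) (i a : Fin 3) :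
    HasPd (correctedField g π i) a x (∑ j,
      ((pd (fun y => π y i j) a x
        - (∑ k, (pd (fun y => g y i k) a x * π x k j
          + (g x i k - kron i k) * pd (fun y => π y k j) a x))
        + ((∑ m, pd (fun y => g y m m) a x) * (1 / 2 * π x i j)
          + (∑ m, (g x m m - kron m m)) * (1 / 2 * pd (fun y => π y i j) a x))) * Yrot j x
      + (π x i j - (∑ k, (g x i k - kron i k) * π x k j)
        + (∑ m, (g x m m - kron m m)) * (1 / 2 * π x i j)) * dYrot a j)) := by
  have hπ' : ∀ i j, HasPd (fun y => π y i j) a x (pd (fun y => π y i j) a x) :=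
    fun i j => ⟨hπ i j, rfl⟩
  have hg' : ∀ i j, HasPd (fun y => g y i j - kron i j) a x (pd (fun y => g y i j) a x) :=
    fun i j => by simpa using HasPd.sub ⟨hg i j, rfl⟩ (HasPd.const (kron i j))
  have hhalf : ∀ i j, HasPd (fun y => 1 / 2 * π y i j) a x (1 / 2 * pd (fun y => π y i j) a x) :=
    fun i j => by simpa using (HasPd.const (1 / 2)).mul (hπ' i j)
  exact HasPd.sum fun j _ => (((hπ' i j).sub (HasPd.sum fun k _ => (hg' i k).mul (hπ' k j))).add
    ((HasPd.sum fun m _ => hg' m m).mul (hhalf i j))).mul (hasPd_Yrot a j x)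

/-- Algebraic form of the divergence of `correctedField`. -/
theorem divergence_correctedField_identity (h P : Fin 3 → Fin 3 → ℝ)
    (d p : Fin 3 → Fin 3 → Fin 3 → ℝ) (Y : Fin 3 → ℝ) (hP : ∀ i j, P i j = P j i) :
    (∑ i, ∑ j, ((p i i j - (∑ k, (d i i k * P k j + h i k * p i k j))
        + ((∑ m, d i m m) * (1 / 2 * P i j) + (∑ m, h m m) * (1 / 2 * p i i j))) * Y j
      + (P i j - (∑ k, h i k * P k j) + (∑ m, h m m) * (1 / 2 * P i j)) * dYrot i j))
      - (1 / 2 * (∑ i, ∑ l, (∑ j, Y j * d j i l) * P i l)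
        + ∑ k, (h 0 k * P k 2 - h 2 k * P k 0))
    = (∑ j, ((∑ i, p i i j) - (∑ i, ∑ k, h i k * p i k j)
      - (∑ i, ∑ k, (d i i k - 1 / 2 * d k i i) * P k j)
      - 1 / 2 * (∑ i, ∑ l, d j i l * P i l)) * Y j)
      + (∑ m, h m m) * (1 / 2 * ∑ j, (∑ i, p i i j) * Y j) := by
  have h1 := hP 1 0
  have h2 := hP 2 0
  have h3 := hP 2 1
  simp only [Fin.sum_univ_three, dYrot, h1, h2, h3]
  simp
  ring

theorem growsLike_divergence_correctedField {g π : E3 → Matrix (Fin 3) (Fin 3) ℝ}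
    {U : Set E3} (hU : IsOpen U) (hUc : U ∈ Bornology.cobounded E3)
    (hgd : ∀ i j, DifferentiableOn ℝ (fun y => g y i j) U)
    (hπd : ∀ i j, DifferentiableOn ℝ (fun y => π y i j) U)
    (hdet : ∀ x ∈ U, IsUnit (g x).det)
    (hgsymm : ∀ x ∈ U, (g x).IsSymm) (hπsymm : ∀ x ∈ U, (π x).IsSymm)
    (hdiv : ∀ x ∈ U, ∀ j, divT g π j x = 0)
    (hg : ∀ i j, GrowsLike (fun x => g x i j - kron i j) (-1))
    (hdg : ∀ i j k, GrowsLike (pd (fun y => g y i j) k) (-2))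
    (hπ : ∀ i j, GrowsLike (fun x => π x i j) (-2))
    (hdπ : ∀ i j k, GrowsLike (pd (fun y => π y i j) k) (-3)) :
    GrowsLike (fun x => (∑ i, pd (correctedField g π i) i x) - lieContraction g π x) (-4) := by
  have hdet' : ∀ᶠ x in Bornology.cobounded E3, IsUnit (g x).det :=
    mem_of_superset hUc hdet
  have hG1 := fun i j => (growsLike_inv hdet' hg i j).1
  have hG2 := fun i j => (growsLike_inv hdet' hg i j).2
  have hG0 : ∀ i j, GrowsLike (fun x => (g x)⁻¹ i j) 0 := fun i j =>
    (((hG1 i j).mono (by norm_num)).add (GrowsLike.const (kron i j))).congr (by simp)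
  set Γ₀ : Fin 3 → Fin 3 → Fin 3 → E3 → ℝ := fun l i j x =>
    1 / 2 * (pd (fun y => g y i l) j x + pd (fun y => g y j l) i x - pd (fun y => g y i j) l x)
    with hΓ₀
  have hΓ₀g : ∀ l i j, GrowsLike (Γ₀ l i j) (-2) := fun l i j =>
    (((hdg i l j).add (hdg j l i)).sub (hdg i j l)).const_mul _
  have hΓ : ∀ l i j, GrowsLike (fun x => Gamma g l i j x - Γ₀ l i j x) (-3) := by
    intro l i j
    have h1 : GrowsLike (fun x => ∑ m, ((g x)⁻¹ l m - kron l m) * Γ₀ m i j x) (-1 + -2) :=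
      GrowsLike.sum fun m _ => (hG1 l m).mul (hΓ₀g m i j)
    norm_num at h1
    refine h1.congr (Eventually.of_forall fun x => ?_)
    simp only [Gamma, hΓ₀, Fin.sum_univ_three]
    fin_cases l <;> simp [kron] <;> ring
  have hGΓ : ∀ i k l j, GrowsLike (fun x => (g x)⁻¹ i k * Gamma g l i j x
      - kron i k * Γ₀ l i j x) (-3) := by
    intro i k l j
    have h1 : GrowsLike (fun x => (g x)⁻¹ i k * (Gamma g l i j x - Γ₀ l i j x)) (-3) := by
      simpa using (hG0 i k).mul (hΓ l i j)
    have h2 : GrowsLike (fun x => ((g x)⁻¹ i k - kron i k) * Γ₀ l i j x) (-1 + -2) :=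
      (hG1 i k).mul (hΓ₀g l i j)
    norm_num at h2
    exact (h1.add h2).congr (Eventually.of_forall fun x => by ring)
  have hQ : ∀ j, GrowsLike (fun x => (∑ i, pd (fun y => π y i j) i x)
      - (∑ i, ∑ k, (g x i k - kron i k) * pd (fun y => π y k j) i x)
      - (∑ i, ∑ k, (pd (fun y => g y i k) i x - 1 / 2 * pd (fun y => g y i i) k x) * π x k j)
      - 1 / 2 * (∑ i, ∑ l, pd (fun y => g y i l) j x * π x i l)) (-5) := by
    intro j
    have h1 : GrowsLike (fun x => ∑ i, ∑ k, ((g x)⁻¹ i k - kron i k + (g x i k - kron i k))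
        * pd (fun y => π y k j) i x) (-2 + -3) :=
      GrowsLike.sum fun i _ => GrowsLike.sum fun k _ => (hG2 i k).mul (hdπ k j i)
    have h2 : GrowsLike (fun x => ∑ i, ∑ k, ∑ l, ((g x)⁻¹ i k * Gamma g l i k x
        - kron i k * Γ₀ l i k x) * π x l j) (-3 + -2) :=
      GrowsLike.sum fun i _ => GrowsLike.sum fun k _ => GrowsLike.sum fun l _ =>
        (hGΓ i k l k).mul (hπ l j)
    have h3 : GrowsLike (fun x => ∑ i, ∑ k, ∑ l, ((g x)⁻¹ i k * Gamma g l i j x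
        - kron i k * Γ₀ l i j x) * π x k l) (-3 + -2) :=
      GrowsLike.sum fun i _ => GrowsLike.sum fun k _ => GrowsLike.sum fun l _ =>
        (hGΓ i k l j).mul (hπ k l)
    norm_num only at h1 h2 h3
    refine ((h1.neg.add h2).add h3).congr ?_
    filter_upwards [hUc] with x hx
    have hsymm : ∀ k a b, pd (fun y => g y a b) k x = pd (fun y => g y b a) k x := by
      intro k a b
      have : (fun y => g y a b) =ᶠ[nhds x] fun y => g y b a := by
        filter_upwards [hU.mem_nhds hx] with y hy
        exact (hgsymm y hy).apply b a
      rw [pd, pd, this.fderiv_eq]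
    have key := linearized_divergence_identity (fun i k => (g x)⁻¹ i k)
      (fun i k => g x i k - kron i k) (fun i k => π x i k) (fun l i k => Gamma g l i k x)
      (fun k a b => pd (fun y => g y a b) k x) (fun k a b => pd (fun y => π y a b) k x)
      (fun a b => (hπsymm x hx).apply b a) hsymm j
    have h0 := hdiv x hx j
    rw [divT] at h0
    rw [key, h0]
    simp only [hΓ₀]
    ring
  have hmain : GrowsLike (fun x => ∑ j, ((∑ i, pd (fun y => π y i j) i x)
      - (∑ i, ∑ k, (g x i k - kron i k) * pd (fun y => π y k j) i x)
      - (∑ i, ∑ k, (pd (fun y => g y i k) i x - 1 / 2 * pd (fun y => g y i i) k x) * π x k j)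
      - 1 / 2 * (∑ i, ∑ l, pd (fun y => g y i l) j x * π x i l)) * Yrot j x) (-5 + 1) :=
    GrowsLike.sum fun j _ => (hQ j).mul (growsLike_Yrot j)
  have hdivflat : ∀ j, GrowsLike (fun x => ∑ i, pd (fun y => π y i j) i x) (-4) := by
    intro j
    have h1 : GrowsLike (fun x => ∑ i, ∑ k, (g x i k - kron i k) * pd (fun y => π y k j) i x)
        (-1 + -3) :=
      GrowsLike.sum fun i _ => GrowsLike.sum fun k _ => (hg i k).mul (hdπ k j i)
    have h2 : GrowsLike (fun x => ∑ i, ∑ k, (pd (fun y => g y i k) i x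
        - 1 / 2 * pd (fun y => g y i i) k x) * π x k j) (-2 + -2) :=
      GrowsLike.sum fun i _ => GrowsLike.sum fun k _ =>
        ((hdg i k i).sub ((hdg i i k).const_mul _)).mul (hπ k j)
    have h3 : GrowsLike (fun x => 1 / 2 * (∑ i, ∑ l, pd (fun y => g y i l) j x * π x i l))
        (-2 + -2) :=
      (GrowsLike.sum fun i _ => GrowsLike.sum fun l _ => (hdg i l j).mul (hπ i l)).const_mul _
    norm_num only at h1 h2 h3
    exact (((((hQ j).mono (by norm_num)).add h1).add h2).add h3).congr
      (Eventually.of_forall fun x => by ring)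
  have htrace : GrowsLike (fun x => (∑ m, (g x m m - kron m m))
      * (1 / 2 * ∑ j, (∑ i, pd (fun y => π y i j) i x) * Yrot j x)) (-1 + (-4 + 1)) :=
    (GrowsLike.sum fun m _ => hg m m).mul
      ((GrowsLike.sum fun j _ => (hdivflat j).mul (growsLike_Yrot j)).const_mul _)
  norm_num only at hmain htrace
  refine (hmain.add htrace).congr ?_
  filter_upwards [hUc] with x hx
  have hpd : ∀ i, pd (correctedField g π i) i x = _ := fun i => (hasPd_correctedField
    (fun a b => (hgd a b).differentiableAt (hU.mem_nhds hx))
    (fun a b => (hπd a b).differentiableAt (hU.mem_nhds hx)) i i).2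
  simp only [hpd]
  exact (divergence_correctedField_identity (fun i k => g x i k - kron i k) (fun i k => π x i k)
    (fun k a b => pd (fun y => g y a b) k x) (fun k a b => pd (fun y => π y a b) k x)
    (fun j => Yrot j x) (fun a b => (hπsymm x hx).apply b a)).symm

/-- The leading part of the metric. -/
def metricModel (A : ℝ) (i j : Fin 3) (x : E3) : ℝ :=
  (1 + A / ‖x‖) * kron i j + (α₅ x / ‖x‖) * (x i * x j / ‖x‖ ^ 2 - kron i j / 2)

/-- The leading part of the tensor `π`. -/
def tensorModel (B : Fin 3 → ℝ) (i j : Fin 3) (x : E3) : ℝ :=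
  β₅ x * (x i * x j) / ‖x‖ ^ 4 + (1 / ‖x‖ ^ 3) *
    (-(B i) * x j - B j * x i + (∑ l, B l * x l) * kron i j)

theorem contDiffOn_norm_compl_zero : ContDiffOn ℝ 1 (fun x : E3 => ‖x‖) {0}ᶜ :=
  fun _ hx => (contDiffAt_norm ℝ hx).contDiffWithinAt

theorem contDiffOn_metricModel (A : ℝ) (i j : Fin 3) :
    ContDiffOn ℝ 1 (metricModel A i j) {0}ᶜ := by
  have hn := contDiffOn_norm_compl_zero
  have h0 : ∀ x ∈ ({0}ᶜ : Set E3), ‖x‖ ≠ 0 := fun x hx => norm_ne_zero_iff.2 hx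
  have h2 : ∀ x ∈ ({0}ᶜ : Set E3), ‖x‖ ^ 2 ≠ 0 := fun x hx => pow_ne_zero 2 (h0 x hx)
  have hx : ∀ k : Fin 3, ContDiffOn ℝ 1 (fun x : E3 => x k) {0}ᶜ := fun k => by fun_prop
  exact ((contDiffOn_const.add (contDiffOn_const.div hn h0)).mul contDiffOn_const).add
    (((((hx 0).pow 2).div (hn.pow 2) h2).div hn h0).mul
      ((((hx i).mul (hx j)).div (hn.pow 2) h2).sub contDiffOn_const))

theorem contDiffOn_tensorModel (B : Fin 3 → ℝ) (i j : Fin 3) :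
    ContDiffOn ℝ 1 (tensorModel B i j) {0}ᶜ := by
  have hn := contDiffOn_norm_compl_zero
  have h0 : ∀ m : ℕ, ∀ x ∈ ({0}ᶜ : Set E3), ‖x‖ ^ m ≠ 0 :=
    fun m x hx => pow_ne_zero m (norm_ne_zero_iff.2 hx)
  have hx : ∀ k : Fin 3, ContDiffOn ℝ 1 (fun x : E3 => x k) {0}ᶜ := fun k => by fun_prop
  exact (((((hx 0).mul (hx 2)).div (hn.pow 2) (h0 2)).mul ((hx i).mul (hx j))).div
    (hn.pow 4) (h0 4)).add ((contDiffOn_const.div (hn.pow 3) (h0 3)).mul (by fun_prop))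

theorem growsLike_metricModel (A : ℝ) (i j : Fin 3) :
    GrowsLike (fun x => metricModel A i j x - kron i j) (-1) ∧
      ∀ k, GrowsLike (pd (metricModel A i j) k) (-2) := by
  have h := growsLike_of_homogeneous (f := fun x => metricModel A i j x - kron i j) (k := 1)
    ((contDiffOn_metricModel A i j).sub contDiffOn_const) ?_
  · refine ⟨by simpa using h.1, fun k => ?_⟩
    have h2 := h.2 k
    norm_num at h2
    refine h2.congr (Eventually.of_forall fun x => ?_)
    rw [pd, pd, fderiv_sub_const]
  · intro t ht x hx
    have hn : ‖x‖ ≠ 0 := norm_ne_zero_iff.2 hx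
    simp only [metricModel, α₅, norm_smul, Real.norm_of_nonneg ht.le, PiLp.smul_apply, smul_eq_mul]
    field_simp
    ring

theorem growsLike_tensorModel (B : Fin 3 → ℝ) (i j : Fin 3) :
    GrowsLike (tensorModel B i j) (-2) ∧ ∀ k, GrowsLike (pd (tensorModel B i j) k) (-3) := by
  have h := growsLike_of_homogeneous (k := 2) (contDiffOn_tensorModel B i j) ?_
  · refine ⟨by simpa using h.1, fun k => ?_⟩
    have h2 := h.2 k
    norm_num at h2
    exact h2
  · intro t ht x hx
    have hn : ‖x‖ ≠ 0 := norm_ne_zero_iff.2 hx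
    simp only [tensorModel, β₅, norm_smul, Real.norm_of_nonneg ht.le, PiLp.smul_apply,
      smul_eq_mul, Fin.sum_univ_three]
    field_simp

/-- The derivative of the leading part of the metric along the rotation field. -/
theorem rotation_deriv_metricModel (A : ℝ) (i l : Fin 3) {x : E3} (hx : x ≠ 0) :
    ∑ j, Yrot j x * pd (metricModel A i l) j x
      = x 0 ^ 2 / ‖x‖ ^ 5 * (Yrot i x * x l + x i * Yrot l x)
        + 2 * (x 0 * x 2) / ‖x‖ ^ 5 * (x i * x l) - x 0 * x 2 / ‖x‖ ^ 3 * kron i l := by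
  have hn : ‖x‖ ≠ 0 := norm_ne_zero_iff.2 hx
  set v : E3 := WithLp.toLp 2 fun k => Yrot k x with hv
  have hvk : ∀ k, v k = Yrot k x := fun k => rfl
  have hline : HasDerivAt (fun t : ℝ => x + t • v) v 0 := by
    simpa using ((hasDerivAt_id (0 : ℝ)).smul_const v).const_add x
  have hcoord : ∀ k : Fin 3, HasDerivAt (fun t : ℝ => (x + t • v) k) (Yrot k x) 0 := fun k => by
    simpa [hvk] using ((hasDerivAt_id (0 : ℝ)).mul_const (v k)).const_add (x k)
  have hinner : inner ℝ x v = 0 := by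
    simp [PiLp.inner_apply, Fin.sum_univ_three, hvk, Yrot]
    ring
  have hsq : HasDerivAt (fun t : ℝ => ‖x + t • v‖ ^ 2) 0 0 := by
    simpa [hinner] using hline.norm_sq
  have hnorm : HasDerivAt (fun t : ℝ => ‖x + t • v‖) 0 0 := by
    have h1 := hsq.sqrt (by simpa using hn)
    simpa [Real.sqrt_sq (norm_nonneg _)] using h1
  have hnorm0 : ‖x + (0 : ℝ) • v‖ ≠ 0 := by simpa using hn
  have hd : HasFDerivAt (metricModel A i l) (fderiv ℝ (metricModel A i l) x) (x + (0 : ℝ) • v) := by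
    rw [zero_smul, add_zero]
    exact (((contDiffOn_metricModel A i l).differentiableOn one_ne_zero).differentiableAt
      (isOpen_compl_singleton.mem_nhds hx)).hasFDerivAt
  have h1 := hd.comp_hasDerivAt 0 hline
  have h2 : HasDerivAt (fun t : ℝ => metricModel A i l (x + t • v)) _ 0 :=
    ((((hasDerivAt_const (0 : ℝ) A).fun_div hnorm hnorm0).const_add 1).mul_const (kron i l)).fun_add
      (((((hcoord 0).fun_pow 2).fun_div (hnorm.fun_pow 2) (pow_ne_zero 2 hnorm0)).fun_div hnorm
        hnorm0).fun_mul ((((hcoord i).fun_mul (hcoord l)).fun_div (hnorm.fun_pow 2)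
          (pow_ne_zero 2 hnorm0)).sub_const (kron i l / 2)))
  have h3 := h1.unique h2
  rw [fderiv_apply_eq_sum_pd] at h3
  simp only [hvk] at h3
  rw [h3]
  have hY0 : Yrot 0 x = x 2 := by simp [Yrot]
  simp [hY0]
  field_simp
  ring

/-- Pointwise evaluation of the contraction of the rotated metric with the tensor. -/
theorem lie_contraction_identity (x Y B : Fin 3 → ℝ) (P : Fin 3 → Fin 3 → ℝ)
    (H K : Fin 3 → Fin 3 → ℝ) (a a' b b' c e : ℝ)
    (hY : ∀ i, Y i = if i = 0 then x 2 else if i = 2 then -(x 0) else 0)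
    (hP : ∀ i j, P i j = c * (x i * x j)
      + e * (-(B i) * x j - B j * x i + (∑ l, B l * x l) * kron i j))
    (hH : ∀ i j, H i j = a * kron i j + b * (x i * x j))
    (hK : ∀ i j, K i j = b * (Y i * x j + x i * Y j) + b' * (x i * x j) - a' * kron i j) :
    1 / 2 * (∑ i, ∑ l, K i l * P i l) + ∑ k, (H 0 k * P k 2 - H 2 k * P k 0)
      = 1 / 2 * (b' * (c * (∑ i, x i ^ 2) ^ 2 - e * (∑ l, B l * x l) * ∑ i, x i ^ 2)
        - a' * (c * (∑ i, x i ^ 2) + e * ∑ l, B l * x l)) := by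
  simp only [hP, hH, hK, hY, Fin.sum_univ_three, kron]
  simp
  ring

theorem growsLike_lieContraction {g π : E3 → Matrix (Fin 3) (Fin 3) ℝ} {q A : ℝ} {B : Fin 3 → ℝ}
    (hg : ∀ i j, GrowsLike (fun x => g x i j - metricModel A i j x) (-1 - q))
    (hdg : ∀ i j k, GrowsLike
      (fun x => pd (fun y => g y i j) k x - pd (metricModel A i j) k x) (-2 - q))
    (hπ : ∀ i j, GrowsLike (fun x => π x i j - tensorModel B i j x) (-2 - q))
    (hπ0 : ∀ i j, GrowsLike (fun x => π x i j) (-2)) :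
    GrowsLike (fun x => lieContraction g π x - (1 / 2 * (x 0 * x 2) ^ 2 / ‖x‖ ^ 7
      - 3 / 2 * (x 0 * x 2) * (∑ l, B l * x l) / ‖x‖ ^ 6)) (-3 - q) := by
  have h1 : GrowsLike (fun x => 1 / 2 * ∑ i, ∑ l, (∑ j, Yrot j x
      * (pd (fun y => g y i l) j x - pd (metricModel A i l) j x)) * π x i l)
      (1 + (-2 - q) + -2) :=
    (GrowsLike.sum fun i _ => GrowsLike.sum fun l _ => (GrowsLike.sum fun j _ =>
      (growsLike_Yrot j).mul (hdg i l j)).mul (hπ0 i l)).const_mul _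
  have h2 : GrowsLike (fun x => 1 / 2 * ∑ i, ∑ l, (∑ j, Yrot j x * pd (metricModel A i l) j x)
      * (π x i l - tensorModel B i l x)) (1 + -2 + (-2 - q)) :=
    (GrowsLike.sum fun i _ => GrowsLike.sum fun l _ => (GrowsLike.sum fun j _ =>
      (growsLike_Yrot j).mul ((growsLike_metricModel A i l).2 j)).mul (hπ i l)).const_mul _
  have h3 : ∀ a b, GrowsLike (fun x => ∑ k, (g x a k - metricModel A a k x) * π x k b)
      (-1 - q + -2) := fun a b => GrowsLike.sum fun k _ => (hg a k).mul (hπ0 k b)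
  have h4 : ∀ a b, GrowsLike (fun x => ∑ k, (metricModel A a k x - kron a k)
      * (π x k b - tensorModel B k b x)) (-1 + (-2 - q)) := fun a b =>
    GrowsLike.sum fun k _ => (growsLike_metricModel A a k).1.mul (hπ k b)
  rw [show 1 + (-2 - q) + -2 = -3 - q by ring] at h1
  rw [show 1 + -2 + (-2 - q) = -3 - q by ring] at h2
  rw [show -1 - q + -2 = -3 - q by ring] at h3
  rw [show -1 + (-2 - q) = -3 - q by ring] at h4
  refine (((h1.add h2).add ((h3 0 2).sub (h3 2 0))).add ((h4 0 2).sub (h4 2 0))).congr ?_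
  filter_upwards [eventually_lt_norm_cobounded 0] with x hx
  have hx0 : x ≠ 0 := norm_pos_iff.1 hx
  have hn : ‖x‖ ≠ 0 := hx.ne'
  have key := lie_contraction_identity (fun i => x i) (fun i => Yrot i x) B
    (fun i j => tensorModel B i j x) (fun i j => metricModel A i j x - kron i j)
    (fun i l => ∑ j, Yrot j x * pd (metricModel A i l) j x)
    (A / ‖x‖ - x 0 ^ 2 / (2 * ‖x‖ ^ 3)) (x 0 * x 2 / ‖x‖ ^ 3) (x 0 ^ 2 / ‖x‖ ^ 5)
    (2 * (x 0 * x 2) / ‖x‖ ^ 5) (x 0 * x 2 / ‖x‖ ^ 6) (1 / ‖x‖ ^ 3) (fun i => rfl) ?_ ?_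
    (fun i l => rotation_deriv_metricModel A i l hx0)
  · rw [← EuclideanSpace.real_norm_sq_eq] at key
    have hval : 1 / 2 * (x 0 * x 2) ^ 2 / ‖x‖ ^ 7
        - 3 / 2 * (x 0 * x 2) * (∑ l, B l * x l) / ‖x‖ ^ 6 = 1 / 2 *
        (2 * (x 0 * x 2) / ‖x‖ ^ 5 * (x 0 * x 2 / ‖x‖ ^ 6 * (‖x‖ ^ 2) ^ 2
          - 1 / ‖x‖ ^ 3 * (∑ l, B l * x l) * ‖x‖ ^ 2)
        - x 0 * x 2 / ‖x‖ ^ 3 * (x 0 * x 2 / ‖x‖ ^ 6 * ‖x‖ ^ 2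
          + 1 / ‖x‖ ^ 3 * ∑ l, B l * x l)) := by
      field_simp
      ring
    rw [hval, ← key]
    simp only [lieContraction, mul_sub, sub_mul, Finset.sum_sub_distrib]
    ring
  · intro i j
    simp only [tensorModel, β₅]
    field_simp
  · intro i j
    simp only [metricModel, α₅]
    field_simp
    ring

theorem integral_sq_sphereMeasure_pos : 0 < ∫ ω, 1 / 2 * (ω 0 * ω 2) ^ 2 ∂sphereMeasure := by
  have hint : Integrable (fun ω : E3 => 1 / 2 * (ω 0 * ω 2) ^ 2) sphereMeasure :=
    integrable_sphereMeasure (by fun_prop)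
  refine (setIntegral_pos_iff_support_of_nonneg_ae
    (Eventually.of_forall fun ω => by simp only [Pi.zero_apply]; positivity) hint).2 ?_
  convert hausdorffMeasure_sphere_inter_pos using 3
  ext ω
  simp

/-- The integral of an odd function over the sphere vanishes. -/
theorem integral_sphereMeasure_of_odd {f : E3 → ℝ} (hf : ∀ x, f (-x) = -f x) :
    ∫ ω, f ω ∂sphereMeasure = 0 := by
  have h := integral_comp_isometry_sphereMeasure (LinearIsometryEquiv.neg ℝ) f
  simp only [LinearIsometryEquiv.coe_neg, hf, integral_neg] at h
  linarith

theorem norm_smul_of_norm_eq_one {ρ : ℝ} (hρ : 0 ≤ ρ) {ω : E3} (hω : ‖ω‖ = 1) : ‖ρ • ω‖ = ρ := by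
  rw [norm_smul, hω, mul_one, Real.norm_of_nonneg hρ]

theorem integral_growsLike_bound {f : E3 → ℝ} {s : ℝ} (hf : GrowsLike f s) :
    ∃ C R : ℝ, 0 < C ∧ ∀ ρ, R ≤ ρ → 0 < ρ →
      |∫ ω, ρ ^ 2 * f (ρ • ω) ∂sphereMeasure| ≤ C * ρ ^ (s + 2) := by
  obtain ⟨C, R, hC, hb⟩ := hf.exists_bound
  refine ⟨C * (sphereMeasure.real Set.univ + 1), R, by positivity, fun ρ hρR hρ => ?_⟩
  have h1 : ‖∫ ω, ρ ^ 2 * f (ρ • ω) ∂sphereMeasure‖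
      ≤ (C * ρ ^ (s + 2)) * sphereMeasure.real Set.univ := by
    refine norm_integral_le_of_norm_le_const ?_
    filter_upwards [ae_norm_eq_one_sphereMeasure] with ω hω
    have hn := norm_smul_of_norm_eq_one hρ.le hω
    have h2 := hb (ρ • ω) (by rwa [hn])
    rw [hn] at h2
    rw [Real.norm_eq_abs, abs_mul, abs_of_nonneg (by positivity : 0 ≤ ρ ^ 2),
      Real.rpow_add hρ, Real.rpow_two]
    nlinarith [mul_le_mul_of_nonneg_left h2 (by positivity : 0 ≤ ρ ^ 2)]
  rw [← Real.norm_eq_abs]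
  refine h1.trans ?_
  have : 0 ≤ C * ρ ^ (s + 2) := by positivity
  nlinarith

/-- A function whose derivative is eventually at least `c / ρ` tends to infinity. -/
theorem tendsto_atTop_of_deriv_ge_div {J J' : ℝ → ℝ} {c R : ℝ} (hc : 0 < c) (hR : 0 < R)
    (hJ : ∀ ρ, R ≤ ρ → HasDerivAt J (J' ρ) ρ) (hJ' : ∀ ρ, R ≤ ρ → c / ρ ≤ J' ρ) :
    Tendsto J atTop atTop := by
  have hd : ∀ ρ, R ≤ ρ → HasDerivAt (fun ρ => J ρ - c * Real.log ρ) (J' ρ - c * ρ⁻¹) ρ :=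
    fun ρ hρ => (hJ ρ hρ).fun_sub ((Real.hasDerivAt_log (hR.trans_le hρ).ne').const_mul c)
  have hmono : MonotoneOn (fun ρ => J ρ - c * Real.log ρ) (Set.Ici R) := by
    refine monotoneOn_of_deriv_nonneg (convex_Ici R)
      (fun ρ hρ => (hd ρ hρ).continuousAt.continuousWithinAt)
      (fun ρ hρ => (hd ρ (interior_subset hρ)).differentiableAt.differentiableWithinAt) ?_
    intro ρ hρ
    have hρ' := interior_subset hρ
    rw [(hd ρ hρ').deriv]
    have := hJ' ρ hρ'
    rw [div_eq_mul_inv] at this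
    linarith
  refine tendsto_atTop_mono' atTop ?_ (tendsto_atTop_add_const_left atTop (J R - c * Real.log R)
    (Real.tendsto_log_atTop.const_mul_atTop hc))
  filter_upwards [eventually_ge_atTop R] with ρ hρ
  have := hmono (Set.mem_Ici.2 le_rfl) hρ hρ
  simp only at this
  linarith

/-- Corollary 3.6 of the paper: with `α = x₁²/r²`, `β = x₁x₃/r²` and
`Y = x₃∂₁ − x₁∂₃`, for any `(ḡ, π̄)` with the corresponding asymptotics and `div_ḡ π̄ = 0`
on an exterior region, the angular momentum surface integrals with respect to `Y`
diverge to `+∞`. -/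
theorem angular_momentum_diverges
    (q : ℝ) (hq₁ : 1 / 2 < q) (hq₂ : q < 1)
    (ρ₀ : ℝ) (hρ₀ : 0 < ρ₀)
    (gb πb : E3 → Matrix (Fin 3) (Fin 3) ℝ)
    (hgreg : ∀ i j, ContDiffOn ℝ 2 (fun x => gb x i j) {x : E3 | ρ₀ ≤ ‖x‖})
    (hgpos : ∀ x : E3, ρ₀ ≤ ‖x‖ → (gb x).PosDef)
    (hgsymm : ∀ x : E3, ρ₀ ≤ ‖x‖ → (gb x).IsSymm)
    (hπreg : ∀ i j, ContDiffOn ℝ 1 (fun x => πb x i j) {x : E3 | ρ₀ ≤ ‖x‖})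
    (hπsymm : ∀ x : E3, ρ₀ ≤ ‖x‖ → (πb x).IsSymm)
    (A : ℝ) (B : Fin 3 → ℝ)
    (hgasymp : ∀ i j, IsO2
      (fun x => gb x i j - ((1 + A / ‖x‖) * kron i j
        + (α₅ x / ‖x‖) * (x i * x j / ‖x‖ ^ 2 - kron i j / 2))) (1 + q) ρ₀)
    (hπasymp : ∀ i j, IsO1
      (fun x => πb x i j - (β₅ x * (x i * x j) / ‖x‖ ^ 4 + (1 / ‖x‖ ^ 3) *
        (-(B i) * x j - B j * x i + (∑ l, B l * x l) * kron i j))) (2 + q) ρ₀)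
    (hdiv : ∀ x : E3, ρ₀ ≤ ‖x‖ → ∀ j, divT gb πb j x = 0) :
    Tendsto (fun ρ : ℝ =>
        sphereIntegral ρ (fun x => ∑ i, ∑ j, πb x i j * Yrot i x * (x j / ρ)))
      atTop atTop := by
  set U : Set E3 := {x : E3 | ρ₀ < ‖x‖} with hUdef
  have hU : IsOpen U := isOpen_lt continuous_const continuous_norm
  have hUc : U ∈ Bornology.cobounded E3 := eventually_lt_norm_cobounded ρ₀
  have hUsub : U ⊆ {x : E3 | ρ₀ ≤ ‖x‖} := fun x (hx : ρ₀ < ‖x‖) =>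
    show ρ₀ ≤ ‖x‖ from hx.le
  have hU0 : U ⊆ {0}ᶜ := by
    rintro x hx rfl
    simp only [hUdef, Set.mem_ofPred_eq, norm_zero] at hx
    linarith
  have hgC : ∀ i j, ContDiffOn ℝ 1 (fun x => gb x i j) U := fun i j =>
    ((hgreg i j).mono hUsub).of_le (by norm_num)
  have hπC : ∀ i j, ContDiffOn ℝ 1 (fun x => πb x i j) U := fun i j => (hπreg i j).mono hUsub
  have hdiff : ∀ {f : E3 → ℝ}, ContDiffOn ℝ 1 f U → ∀ x ∈ U, DifferentiableAt ℝ f x :=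
    fun hf x hx => (hf.differentiableOn one_ne_zero).differentiableAt (hU.mem_nhds hx)
  have hgerr : ∀ i j, GrowsLike (fun x => gb x i j - metricModel A i j x) (-1 - q) ∧
      ∀ k, GrowsLike (fun x => pd (fun y => gb y i j) k x - pd (metricModel A i j) k x)
        (-2 - q) := by
    intro i j
    obtain ⟨C, hC⟩ := hgasymp i j
    refine ⟨?_, fun k => ?_⟩
    · have h1 := GrowsLike.of_bound fun x hx => (hC x hx).1
      rwa [show -(1 + q) = -1 - q by ring] at h1
    · have h1 := GrowsLike.of_bound fun x hx => (hC x hx).2.1 k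
      rw [show -(1 + q) - 1 = -2 - q by ring] at h1
      refine h1.congr ?_
      filter_upwards [hUc] with x hx
      exact (HasPd.sub ⟨hdiff (hgC i j) x hx, rfl⟩
        ⟨hdiff ((contDiffOn_metricModel A i j).mono hU0) x hx, rfl⟩).2
  have hπerr : ∀ i j, GrowsLike (fun x => πb x i j - tensorModel B i j x) (-2 - q) ∧
      ∀ k, GrowsLike (fun x => pd (fun y => πb y i j) k x - pd (tensorModel B i j) k x)
        (-3 - q) := by
    intro i j
    obtain ⟨C, hC⟩ := hπasymp i j
    refine ⟨?_, fun k => ?_⟩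
    · have h1 := GrowsLike.of_bound fun x hx => (hC x hx).1
      rwa [show -(2 + q) = -2 - q by ring] at h1
    · have h1 := GrowsLike.of_bound fun x hx => (hC x hx).2 k
      rw [show -(2 + q) - 1 = -3 - q by ring] at h1
      refine h1.congr ?_
      filter_upwards [hUc] with x hx
      exact (HasPd.sub ⟨hdiff (hπC i j) x hx, rfl⟩
        ⟨hdiff ((contDiffOn_tensorModel B i j).mono hU0) x hx, rfl⟩).2
  have hg : ∀ i j, GrowsLike (fun x => gb x i j - kron i j) (-1) := fun i j =>
    (((hgerr i j).1.mono (by linarith)).add (growsLike_metricModel A i j).1).congr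
      (Eventually.of_forall fun x => by ring)
  have hdg : ∀ i j k, GrowsLike (pd (fun y => gb y i j) k) (-2) := fun i j k =>
    ((((hgerr i j).2 k).mono (by linarith)).add ((growsLike_metricModel A i j).2 k)).congr
      (Eventually.of_forall fun x => by ring)
  have hπ : ∀ i j, GrowsLike (fun x => πb x i j) (-2) := fun i j =>
    (((hπerr i j).1.mono (by linarith)).add (growsLike_tensorModel B i j).1).congr
      (Eventually.of_forall fun x => by ring)
  have hdπ : ∀ i j k, GrowsLike (pd (fun y => πb y i j) k) (-3) := fun i j k =>
    ((((hπerr i j).2 k).mono (by linarith)).add ((growsLike_tensorModel B i j).2 k)).congr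
      (Eventually.of_forall fun x => by ring)
  have hdivV := growsLike_divergence_correctedField hU hUc
    (fun i j => (hgC i j).differentiableOn one_ne_zero)
    (fun i j => (hπC i j).differentiableOn one_ne_zero)
    (fun x hx => (hgpos x (hUsub hx)).det_pos.ne'.isUnit)
    (fun x hx => hgsymm x (hUsub hx)) (fun x hx => hπsymm x (hUsub hx))
    (fun x hx => hdiv x (hUsub hx)) hg hdg hπ hdπ
  have hlie := growsLike_lieContraction (fun i j => (hgerr i j).1) (fun i j => (hgerr i j).2)
    (fun i j => (hπerr i j).1) hπ
  set V := correctedField gb πb with hV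
  have hY : ∀ j, ContDiff ℝ 1 (Yrot j) := fun j => by
    unfold Yrot
    split_ifs <;> fun_prop
  have hVC : ∀ i, ContDiffOn ℝ 1 (V i) U := fun i =>
    ContDiffOn.sum fun j _ => (((hπC i j).sub (ContDiffOn.sum fun k _ =>
      ((hgC i k).sub contDiffOn_const).mul (hπC k j))).add
      ((ContDiffOn.sum fun m _ => (hgC m m).sub contDiffOn_const).mul
        (contDiffOn_const.mul (hπC i j)))).mul (hY j).contDiffOn
  have hmem : ∀ ρ, ρ₀ < ρ → ∀ ω ∈ Metric.sphere (0 : E3) 1, ρ • ω ∈ U := by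
    intro ρ hρ ω hω
    have := norm_smul_of_norm_eq_one (hρ₀.trans hρ).le (mem_sphere_zero_iff_norm.1 hω)
    simpa only [hUdef, Set.mem_ofPred_eq, this] using hρ
  have herr := (hdivV.mono (by linarith : (-4 : ℝ) ≤ -3 - q)).add hlie
  obtain ⟨C, R₁, hC, hbound⟩ := integral_growsLike_bound herr
  set c : ℝ := ∫ ω, 1 / 2 * (ω 0 * ω 2) ^ 2 ∂sphereMeasure with hc
  have hcpos : 0 < c := integral_sq_sphereMeasure_pos
  have hJ' : ∀ ρ, ρ₀ < ρ → R₁ ≤ ρ → c / ρ - C * ρ ^ (-1 - q)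
      ≤ ∫ ω, ρ ^ 2 * ∑ i, pd (V i) i (ρ • ω) ∂sphereMeasure := by
    intro ρ hρ hρR
    have hρpos : 0 < ρ := hρ₀.trans hρ
    have hodd : ∫ ω : E3, 3 / 2 * (ω 0 * ω 2) * (∑ l, B l * ω l) ∂sphereMeasure = 0 :=
      integral_sphereMeasure_of_odd fun x => by
        simp [Fin.sum_univ_three]
        ring
    have hi1 : Integrable (fun ω : E3 => 1 / 2 * (ω 0 * ω 2) ^ 2) sphereMeasure :=
      integrable_sphereMeasure (by fun_prop)
    have hi2 : Integrable (fun ω : E3 => 3 / 2 * (ω 0 * ω 2) * (∑ l, B l * ω l)) sphereMeasure :=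
      integrable_sphereMeasure (by fun_prop)
    have hi3 : Integrable (fun ω : E3 => ρ ^ 2 * ∑ i, pd (V i) i (ρ • ω)) sphereMeasure :=
      integrable_sphereMeasure (continuousOn_const.mul (continuousOn_finsetSum _ fun i _ =>
        (continuousOn_pd hU (hVC i) i).comp (by fun_prop) (hmem ρ hρ)))
    have hi4 : Integrable (fun ω : E3 => ρ⁻¹ * (1 / 2 * (ω 0 * ω 2) ^ 2
        - 3 / 2 * (ω 0 * ω 2) * (∑ l, B l * ω l))) sphereMeasure := (hi1.sub hi2).const_mul _
    have hb := hbound ρ hρR hρpos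
    have heq : ∫ ω, ρ ^ 2 * ((∑ i, pd (V i) i (ρ • ω)) - lieContraction gb πb (ρ • ω)
        + (lieContraction gb πb (ρ • ω) - (1 / 2 * ((ρ • ω) 0 * (ρ • ω) 2) ^ 2 / ‖ρ • ω‖ ^ 7
          - 3 / 2 * ((ρ • ω) 0 * (ρ • ω) 2) * (∑ l, B l * (ρ • ω) l) / ‖ρ • ω‖ ^ 6)))
          ∂sphereMeasure
        = ∫ ω, (ρ ^ 2 * (∑ i, pd (V i) i (ρ • ω)) - ρ⁻¹ * (1 / 2 * (ω 0 * ω 2) ^ 2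
          - 3 / 2 * (ω 0 * ω 2) * (∑ l, B l * ω l))) ∂sphereMeasure := by
      refine integral_congr_ae ?_
      filter_upwards [ae_norm_eq_one_sphereMeasure] with ω hω
      rw [norm_smul_of_norm_eq_one hρpos.le hω]
      simp only [PiLp.smul_apply, smul_eq_mul, Fin.sum_univ_three]
      field_simp
      ring
    rw [heq, integral_sub hi3 hi4, integral_const_mul ρ⁻¹,
      integral_sub hi1 hi2, hodd, sub_zero, ← hc, show -3 - q + 2 = -1 - q by ring] at hb
    have := (abs_le.1 hb).1
    rw [div_eq_inv_mul]
    linarith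
  have hsmall : ∀ᶠ ρ : ℝ in atTop, C * ρ ^ (-q) ≤ c / 2 := by
    have h1 := (tendsto_rpow_neg_atTop (by linarith : 0 < q)).const_mul C
    rw [mul_zero] at h1
    exact (h1.eventually_lt_const (by linarith : 0 < c / 2)).mono fun ρ h => h.le
  obtain ⟨R₂, hR₂⟩ := eventually_atTop.1 hsmall
  have hJtends : Tendsto (fun ρ : ℝ => ∫ ω, ρ ^ 2 * ∑ i, V i (ρ • ω) * ω i ∂sphereMeasure)
      atTop atTop := by
    refine tendsto_atTop_of_deriv_ge_div (c := c / 2) (R := max (ρ₀ + 1) (max R₁ R₂))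
      (J' := fun ρ => ∫ ω, ρ ^ 2 * ∑ i, pd (V i) i (ρ • ω) ∂sphereMeasure)
      (by linarith) (lt_max_of_lt_left (by linarith)) (fun ρ hρ => ?_) fun ρ hρ => ?_
    · have h1 : ρ₀ + 1 ≤ ρ := (le_max_left _ _).trans hρ
      exact hasDerivAt_flux hρ₀ hVC (by linarith)
    · have h1 : ρ₀ + 1 ≤ ρ := (le_max_left _ _).trans hρ
      have h2 : R₁ ≤ ρ := ((le_max_left _ _).trans (le_max_right _ _)).trans hρ
      have h3 : R₂ ≤ ρ := ((le_max_right _ _).trans (le_max_right _ _)).trans hρ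
      have hρpos : 0 < ρ := by linarith
      refine le_trans ?_ (hJ' ρ (by linarith) h2)
      have h4 := mul_le_mul_of_nonneg_right (hR₂ ρ h3) (inv_nonneg.2 hρpos.le)
      rw [show -1 - q = -q + -1 by ring, Real.rpow_add hρpos, Real.rpow_neg_one, div_eq_mul_inv,
        div_eq_mul_inv c ρ]
      linarith
  have hcorr : ∀ j, GrowsLike (fun x => (∑ i, πb x i j * Yrot i x) - V j x) (-2) := by
    intro j
    have h1 : GrowsLike (fun x => ∑ i, ((∑ k, (gb x j k - kron j k) * πb x k i)
        - (∑ m, (gb x m m - kron m m)) * (1 / 2 * πb x j i)) * Yrot i x) (-1 + -2 + 1) :=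
      GrowsLike.sum fun i _ => ((GrowsLike.sum fun k _ => (hg j k).mul (hπ k i)).sub
        ((GrowsLike.sum fun m _ => hg m m).mul ((hπ j i).const_mul _))).mul (growsLike_Yrot i)
    norm_num only at h1
    refine h1.congr ?_
    filter_upwards [hUc] with x hx
    rw [hV, correctedField, ← Finset.sum_sub_distrib]
    refine Finset.sum_congr rfl fun i _ => ?_
    rw [(hπsymm x (hUsub hx)).apply j i]
    ring
  have hflux : GrowsLike
      (fun x => ∑ j, ((∑ i, πb x i j * Yrot i x) - V j x) * (x j / ‖x‖)) (-2) := by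
    refine GrowsLike.sum fun j _ => ?_
    have h1 : GrowsLike (fun x : E3 => x j / ‖x‖) 0 := by
      refine GrowsLike.of_bound (C := 1) (ρ₀ := 0) fun x _ => ?_
      rw [Real.rpow_zero, mul_one, abs_div, abs_norm]
      exact div_le_one_of_le₀ (PiLp.norm_apply_le x j) (norm_nonneg x)
    simpa using (hcorr j).mul h1
  obtain ⟨C', R₃, -, hbound'⟩ := integral_growsLike_bound hflux
  refine tendsto_atTop_mono' atTop ?_ (tendsto_atTop_add_const_right atTop (-C') hJtends)
  filter_upwards [eventually_gt_atTop ρ₀, eventually_ge_atTop R₃] with ρ hρ hρ3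
  have hρpos : 0 < ρ := hρ₀.trans hρ
  have hb := hbound' ρ hρ3 hρpos
  rw [neg_add_cancel, Real.rpow_zero, mul_one] at hb
  have hcont : ∀ {f : E3 → ℝ}, ContDiffOn ℝ 1 f U →
      ContinuousOn (fun ω => f (ρ • ω)) (Metric.sphere 0 1) :=
    fun hf => hf.continuousOn.comp (by fun_prop) (hmem ρ hρ)
  have heq : ∫ ω, ρ ^ 2 * ∑ j, ((∑ i, πb (ρ • ω) i j * Yrot i (ρ • ω)) - V j (ρ • ω))
        * ((ρ • ω) j / ‖ρ • ω‖) ∂sphereMeasure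
      = sphereIntegral ρ (fun x => ∑ i, ∑ j, πb x i j * Yrot i x * (x j / ρ))
        - ∫ ω, ρ ^ 2 * ∑ i, V i (ρ • ω) * ω i ∂sphereMeasure := by
    rw [sphereIntegral_eq_integral_sphereMeasure hρpos, ← integral_sub]
    · refine integral_congr_ae ?_
      filter_upwards [ae_norm_eq_one_sphereMeasure] with ω hω
      rw [norm_smul_of_norm_eq_one hρpos.le hω]
      simp only [PiLp.smul_apply, smul_eq_mul, Fin.sum_univ_three]
      field_simp
      ring
    · refine integrable_sphereMeasure (continuousOn_const.mul (continuousOn_finsetSum _ fun i _ =>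
        continuousOn_finsetSum _ fun j _ => ((hcont (hπC i j)).mul
          (hcont (hY i).contDiffOn)).mul (by fun_prop)))
    · exact integrable_sphereMeasure (continuousOn_const.mul (continuousOn_finsetSum _ fun i _ =>
        (hcont (hVC i)).mul (by fun_prop)))
  rw [heq] at hb
  linarith [(abs_le.1 hb).1]
end
end

section
/- Let α(x) = x₁²/r², β(x) = x₁x₃/r², and Y(x) = (x₃, 0, −x₁). Then for every x ∈ ℝ³∖{0}, (1/4) Σ_p (∂_p α)(x) β(x) Y^p(x) / r³ = x₁² x₃² / (2 r⁷); moreover, for any fixed ρ₀ > 0, the integral (1/2)∫_{ρ₀ ≤ |x| ≤ ρ} x₁² x₃² / |x|⁷ dx tends to +∞ as ρ → ∞. -/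
open MeasureTheory Filter

noncomputable section

/-- `α(x) = x₁²/r²`. -/
def α₆ (x : E3) : ℝ := (x 0) ^ 2 / ‖x‖ ^ 2

/-- `β(x) = x₁x₃/r²`. -/
def β₆ (x : E3) : ℝ := x 0 * x 2 / ‖x‖ ^ 2

/-- Integral of `f` over the annulus `{ρ₀ ≤ ‖x‖ ≤ ρ}` with respect to Lebesgue measure. -/
def annulusIntegral (ρ₀ ρ : ℝ) (f : E3 → ℝ) : ℝ :=
  ∫ x in {x : E3 | ρ₀ ≤ ‖x‖ ∧ ‖x‖ ≤ ρ}, f x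

/-- The derivative of `α` in the direction `v`. -/
lemma fderiv_α₆_apply {x : E3} (hx : x ≠ 0) (v : E3) :
    fderiv ℝ α₆ x v =
      2 * x 0 * v 0 / ‖x‖ ^ 2 - 2 * (x 0) ^ 2 * inner ℝ x v / ‖x‖ ^ 4 := by
  have hn : ‖x‖ ≠ 0 := norm_ne_zero_iff.mpr hx
  have hcoord : HasFDerivAt (fun y : E3 => y 0) (EuclideanSpace.proj (𝕜 := ℝ) (0 : Fin 3)) x :=
    (EuclideanSpace.proj (𝕜 := ℝ) (0 : Fin 3)).hasFDerivAt
  have hnorm : HasFDerivAt (fun y : E3 => ‖y‖ ^ 2) (2 • innerSL ℝ x) x :=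
    (hasStrictFDerivAt_norm_sq x).hasFDerivAt
  have hα : HasFDerivAt α₆ _ x := (hcoord.pow 2).mul
    ((hasDerivAt_inv (pow_ne_zero 2 hn)).comp_hasFDerivAt x hnorm)
  rw [hα.fderiv]
  simp
  field_simp
  ring

/-- The integrand `x₁² x₃² / r⁷`. -/
def shellDensity (x : E3) : ℝ := (x 0) ^ 2 * (x 2) ^ 2 / ‖x‖ ^ 7

lemma shellDensity_nonneg (x : E3) : 0 ≤ shellDensity x := by
  unfold shellDensity
  positivity

/-- The integrand is homogeneous of degree `-3`. -/
lemma shellDensity_smul {R : ℝ} (hR : 0 < R) (x : E3) :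
    shellDensity (R • x) = (R ^ 3)⁻¹ * shellDensity x := by
  have hcoord : ∀ i, (R • x) i = R * x i := fun i => rfl
  unfold shellDensity
  rw [norm_smul, Real.norm_of_nonneg hR.le, hcoord, hcoord]
  rcases eq_or_ne x 0 with rfl | hx
  · simp
  · have hn : ‖x‖ ≠ 0 := norm_ne_zero_iff.mpr hx
    field_simp

lemma integrableOn_shellDensity {a : ℝ} (ha : 0 < a) (b : ℝ) :
    IntegrableOn shellDensity {x : E3 | a ≤ ‖x‖ ∧ ‖x‖ ≤ b} := by
  have hclosed : IsClosed {x : E3 | a ≤ ‖x‖ ∧ ‖x‖ ≤ b} :=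
    (isClosed_le continuous_const continuous_norm).inter
      (isClosed_le continuous_norm continuous_const)
  have hcompact : IsCompact {x : E3 | a ≤ ‖x‖ ∧ ‖x‖ ≤ b} :=
    (isCompact_closedBall (0 : E3) b).of_isClosed_subset hclosed
      fun x hx => mem_closedBall_zero_iff.mpr hx.2
  refine ContinuousOn.integrableOn_compact hcompact ?_
  unfold shellDensity
  refine ContinuousOn.div (by fun_prop) (by fun_prop) fun x hx => ?_
  exact pow_ne_zero 7 (ha.trans_le hx.1).ne'

lemma monotone_annulusIntegral_shellDensity {a : ℝ} (ha : 0 < a) :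
    Monotone fun b => annulusIntegral a b shellDensity := fun _ c hbc =>
  setIntegral_mono_set (integrableOn_shellDensity ha c) (ae_of_all _ shellDensity_nonneg)
    (LE.le.eventuallyLE fun _ hx => ⟨hx.1, hx.2.trans hbc⟩)

open scoped Pointwise in
lemma smul_shell {R : ℝ} (hR : 0 < R) (a b : ℝ) :
    R • {x : E3 | a < ‖x‖ ∧ ‖x‖ ≤ b} = {x : E3 | R * a < ‖x‖ ∧ ‖x‖ ≤ R * b} := by
  ext x
  rw [Set.mem_smul_set_iff_inv_smul_mem₀ hR.ne']
  simp only [Set.mem_ofPred_eq, norm_smul, norm_inv, Real.norm_of_nonneg hR.le]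
  rw [lt_inv_mul_iff₀ hR, inv_mul_le_iff₀ hR]

/-- The integral over a spherical shell is invariant under dilation. -/
lemma setIntegral_shellDensity_dilate {R : ℝ} (hR : 0 < R) (a b : ℝ) :
    ∫ x in {x : E3 | R * a < ‖x‖ ∧ ‖x‖ ≤ R * b}, shellDensity x =
      ∫ x in {x : E3 | a < ‖x‖ ∧ ‖x‖ ≤ b}, shellDensity x := by
  have h := Measure.setIntegral_comp_smul_of_pos (volume : Measure E3) shellDensity
    {x : E3 | a < ‖x‖ ∧ ‖x‖ ≤ b} hR
  simp only [shellDensity_smul hR, smul_shell hR, integral_const_mul, finrank_euclideanSpace,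
    Fintype.card_fin, smul_eq_mul] at h
  exact (mul_left_cancel₀ (inv_ne_zero (pow_ne_zero 3 hR.ne')) h).symm

lemma setIntegral_shellDensity_pos {a : ℝ} (ha : 0 < a) :
    0 < ∫ x in {x : E3 | a < ‖x‖ ∧ ‖x‖ ≤ 2 * a}, shellDensity x := by
  have hint : IntegrableOn shellDensity {x : E3 | a < ‖x‖ ∧ ‖x‖ ≤ 2 * a} :=
    (integrableOn_shellDensity ha (2 * a)).mono_set fun x hx => ⟨hx.1.le, hx.2⟩
  rw [setIntegral_pos_iff_support_of_nonneg_ae (ae_of_all _ shellDensity_nonneg) hint]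
  let U : Set E3 := {x | (a < ‖x‖ ∧ ‖x‖ < 2 * a) ∧ x 0 ≠ 0 ∧ x 2 ≠ 0}
  have hopen : IsOpen U :=
    ((isOpen_lt continuous_const continuous_norm).inter
      (isOpen_lt continuous_norm continuous_const)).inter
      ((isOpen_ne_fun (by fun_prop) continuous_const).inter
        (isOpen_ne_fun (by fun_prop) continuous_const))
  have hnonempty : U.Nonempty := by
    have hsq : ‖(!₂[a, 0, a] : E3)‖ ^ 2 = 2 * a ^ 2 := by
      rw [EuclideanSpace.real_norm_sq_eq, Fin.sum_univ_three]
      simp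
      ring
    refine ⟨!₂[a, 0, a], ⟨?_, ?_⟩, by simpa using ha.ne', by simpa using ha.ne'⟩
    · exact lt_of_pow_lt_pow_left₀ 2 (norm_nonneg _) (by rw [hsq]; nlinarith)
    · exact lt_of_pow_lt_pow_left₀ 2 (by positivity) (by rw [hsq]; nlinarith)
  refine (hopen.measure_pos volume hnonempty).trans_le (measure_mono ?_)
  rintro x ⟨⟨hlo, hhi⟩, h0, h2⟩
  refine ⟨?_, hlo, hhi.le⟩
  have hn : ‖x‖ ≠ 0 := (ha.trans hlo).ne'
  exact div_ne_zero (mul_ne_zero (pow_ne_zero 2 h0) (pow_ne_zero 2 h2)) (pow_ne_zero 7 hn)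

lemma annulusIntegral_shellDensity_add {a b c : ℝ} (ha : 0 < a) (hab : a ≤ b) (hbc : b ≤ c) :
    annulusIntegral a c shellDensity = annulusIntegral a b shellDensity +
      ∫ x in {x : E3 | b < ‖x‖ ∧ ‖x‖ ≤ c}, shellDensity x := by
  have hunion : {x : E3 | a ≤ ‖x‖ ∧ ‖x‖ ≤ c} =
      {x : E3 | a ≤ ‖x‖ ∧ ‖x‖ ≤ b} ∪ {x : E3 | b < ‖x‖ ∧ ‖x‖ ≤ c} := by
    ext x
    simp only [Set.mem_union, Set.mem_ofPred_eq]
    grind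
  unfold annulusIntegral
  rw [hunion]
  refine setIntegral_union ?_ ?_ (integrableOn_shellDensity ha b) ?_
  · exact Set.disjoint_left.mpr fun x hx hx' => hx.2.not_gt hx'.1
  · exact (measurableSet_lt measurable_const measurable_norm).inter
      (measurableSet_le measurable_norm measurable_const)
  · exact (integrableOn_shellDensity ha c).mono_set fun x hx => ⟨hab.trans hx.1.le, hx.2⟩

/-- The integral over the union of `n` dyadic shells grows at least linearly in `n`. -/
lemma nsmul_le_annulusIntegral_shellDensity {a : ℝ} (ha : 0 < a) (n : ℕ) :
    n • ∫ x in {x : E3 | a < ‖x‖ ∧ ‖x‖ ≤ 2 * a}, shellDensity x ≤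
      annulusIntegral a (2 ^ n * a) shellDensity := by
  induction n with
  | zero =>
    rw [zero_smul]
    exact integral_nonneg shellDensity_nonneg
  | succ n ih =>
    have hpow : (1 : ℝ) ≤ 2 ^ n := one_le_pow₀ one_le_two
    have hstep : (2 : ℝ) ^ (n + 1) * a = 2 ^ n * (2 * a) := by ring
    rw [hstep, annulusIntegral_shellDensity_add ha (b := 2 ^ n * a) (by nlinarith) (by nlinarith),
      setIntegral_shellDensity_dilate (by positivity), succ_nsmul]
    gcongr

lemma tendsto_annulusIntegral_shellDensity {a : ℝ} (ha : 0 < a) :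
    Tendsto (fun b => annulusIntegral a b shellDensity) atTop atTop := by
  refine tendsto_atTop_atTop_of_monotone (monotone_annulusIntegral_shellDensity ha) fun M => ?_
  obtain ⟨n, hn⟩ := Archimedean.arch M (setIntegral_shellDensity_pos ha)
  exact ⟨2 ^ n * a, hn.trans (nsmul_le_annulusIntegral_shellDensity ha n)⟩

/-- with `α = x₁²/r²`, `β = x₁x₃/r²` and `Y(x) = (x₃, 0, −x₁)`, one has the
pointwise identity `(1/4) Σ_p (∂_p α) β Y^p / r³ = x₁² x₃² / (2r⁷)` on `ℝ³∖{0}`, and for any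
`ρ₀ > 0` the integrals `(1/2) ∫_{ρ₀ ≤ |x| ≤ ρ} x₁² x₃²/|x|⁷ dx` tend to `+∞` as `ρ → ∞`. -/
theorem divergent_integrand_identity_and_divergence :
    (∀ x : E3, x ≠ 0 →
      (1 / 4) * ∑ p, pd α₆ p x * β₆ x * Yrot p x / ‖x‖ ^ 3
        = (x 0) ^ 2 * (x 2) ^ 2 / (2 * ‖x‖ ^ 7)) ∧
    ∀ ρ₀ : ℝ, 0 < ρ₀ →
      Tendsto (fun ρ : ℝ =>
          (1 / 2) * annulusIntegral ρ₀ ρ (fun x => (x 0) ^ 2 * (x 2) ^ 2 / ‖x‖ ^ 7))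
        atTop atTop := by
  refine ⟨fun x hx => ?_, fun ρ₀ hρ₀ =>
    (tendsto_annulusIntegral_shellDensity hρ₀).const_mul_atTop (by norm_num)⟩
  have hn : ‖x‖ ≠ 0 := norm_ne_zero_iff.mpr hx
  simp only [Fin.sum_univ_three, pd, fderiv_α₆_apply hx, β₆, Yrot]
  simp [EuclideanSpace.inner_single_right]
  field_simp
  ring
end
end
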